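/- arXiv:2406.05526 — 3 statements merged into one kernel-verified Lean document; each statement's English description precedes it below -/
import Mathlib

section
/- Strict improvement, underpricing case: let (u,p) ∈ S and suppose the set Γ := { t ∈ [0,T] : p(t) < a·u(t) + α(t)/(2β(t)) and u(t) > 0 } has positive Lebesgue measure. Then there exists (ũ,p̃) ∈ S whose inventory trajectory coincides with that of (u,p) on [0,T] and such that J_σ(ũ,p̃) > J_σ(u,p); in particular (u,p) is not optimal for J_σ. -/
open MeasureTheory Set
open scoped NNReal

noncomputable section

/-- Combined holding/shortage cost with holding factor `Ch` and shortage factor `Cs`. -/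
def holding (Ch Cs x : ℝ) : ℝ := if x < 0 then Cs * x ^ 2 else Ch * x ^ 2

/-- Membership in the policy space `S`. -/
def memS (T a : ℝ) (α β : ℝ → ℝ) (u p : ℝ → ℝ) : Prop :=
  Measurable u ∧ Measurable p ∧
  ∀ t ∈ Icc (0 : ℝ) T,
    0 ≤ u t ∧ u t ≤ α t / (2 * a * β t) ∧ 0 ≤ p t ∧ p t ≤ α t / β t

/-- Inventory trajectory under production rate `u` and price `p`. -/
def traj (α β : ℝ → ℝ) (x₀ : ℝ) (u p : ℝ → ℝ) (t : ℝ) : ℝ :=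
  x₀ + ∫ s in (0 : ℝ)..t, (u s - max (α s - β s * p s) 0)

/-- The objective `J_σ(u,p)`. -/
def Jobj (T a σ Ch Cs ChT CsT : ℝ) (α β : ℝ → ℝ) (x₀ : ℝ) (u p : ℝ → ℝ) : ℝ :=
  (∫ s in (0 : ℝ)..T,
    (p s * max (α s - β s * p s) 0 - a * u s ^ 2 - holding Ch Cs (traj α β x₀ u p s)))
  - holding ChT CsT (traj α β x₀ u p T)
  - σ * sSup (traj α β x₀ u p '' Icc 0 T)

theorem continuous_holding (Ch Cs : ℝ) : Continuous (holding Ch Cs) := by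
  unfold holding
  refine Continuous.if ?_ (by fun_prop) (by fun_prop)
  intro x hx
  have hx0 : x = 0 := by
    have := frontier_lt_subset_eq continuous_id continuous_const hx
    simpa using this
  simp [hx0]

/-- A measurable policy component bounded by a function continuous on `[0,T]` is integrable. -/
theorem integrableOn_Icc_of_abs_le {T : ℝ} {f g : ℝ → ℝ}
    (hf : AEStronglyMeasurable f (volume.restrict (Icc 0 T)))
    (hg : ContinuousOn g (Icc 0 T)) (hfg : ∀ t ∈ Icc (0 : ℝ) T, |f t| ≤ g t) :
    IntegrableOn f (Icc 0 T) :=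
  Integrable.mono' hg.integrableOn_Icc hf
    ((ae_restrict_iff' measurableSet_Icc).2 (Filter.Eventually.of_forall hfg))

section Policy

variable {T a : ℝ} {α β u p : ℝ → ℝ}

theorem memS.demand_nonneg (h : memS T a α β u p) (hβ : ∀ t ∈ Icc (0 : ℝ) T, 0 < β t)
    {t : ℝ} (ht : t ∈ Icc 0 T) : 0 ≤ α t - β t * p t := by
  have h1 := (h.2.2 t ht).2.2.2
  rw [le_div_iff₀ (hβ t ht)] at h1
  linarith

theorem aestronglyMeasurable_demand (hp : Measurable p)
    (hαc : ContinuousOn α (Icc 0 T)) (hβc : ContinuousOn β (Icc 0 T)) :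
    AEStronglyMeasurable (fun s => max (α s - β s * p s) 0) (volume.restrict (Icc 0 T)) := by
  have h1 := hαc.aestronglyMeasurable (μ := volume) measurableSet_Icc
  have h2 := hβc.aestronglyMeasurable (μ := volume) measurableSet_Icc
  exact (h1.sub (h2.mul hp.aestronglyMeasurable)).sup aestronglyMeasurable_const

theorem memS.demand_abs_le (h : memS T a α β u p) (hβ : ∀ t ∈ Icc (0 : ℝ) T, 0 < β t)
    {t : ℝ} (ht : t ∈ Icc 0 T) : |max (α t - β t * p t) 0| ≤ α t := by
  have h1 := h.demand_nonneg hβ ht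
  have h2 := mul_nonneg (hβ t ht).le (h.2.2 t ht).2.2.1
  rw [max_eq_left h1, abs_of_nonneg h1]
  linarith

theorem continuousOn_traj (h : memS T a α β u p) (hT : 0 < T) (ha : 0 < a)
    (hαc : ContinuousOn α (Icc 0 T)) (hβc : ContinuousOn β (Icc 0 T))
    (hβ : ∀ t ∈ Icc (0 : ℝ) T, 0 < β t) (x₀ : ℝ) :
    ContinuousOn (traj α β x₀ u p) (Icc 0 T) := by
  have hu : IntegrableOn u (Icc 0 T) := by
    refine integrableOn_Icc_of_abs_le h.1.aestronglyMeasurable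
      (hαc.div (continuousOn_const.mul hβc) fun t ht =>
        (mul_pos (mul_pos two_pos ha) (hβ t ht)).ne') fun t ht => ?_
    rw [abs_of_nonneg (h.2.2 t ht).1]
    exact (h.2.2 t ht).2.1
  have hd : IntegrableOn (fun s => max (α s - β s * p s) 0) (Icc 0 T) :=
    integrableOn_Icc_of_abs_le (aestronglyMeasurable_demand h.2.1 hαc hβc) hαc
      fun t ht => h.demand_abs_le hβ ht
  have hi := intervalIntegral.continuousOn_primitive_interval (μ := volume)
    (f := fun s => u s - max (α s - β s * p s) 0) (a := 0) (b := T)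
    (by rw [uIcc_of_le hT.le]; exact hu.sub hd)
  rw [uIcc_of_le hT.le] at hi
  exact continuousOn_const.add hi

theorem intervalIntegrable_profit (h : memS T a α β u p) (hT : 0 < T) (ha : 0 < a)
    (hαc : ContinuousOn α (Icc 0 T)) (hβc : ContinuousOn β (Icc 0 T))
    (hβ : ∀ t ∈ Icc (0 : ℝ) T, 0 < β t) (x₀ Ch Cs : ℝ) :
    IntervalIntegrable (fun s => p s * max (α s - β s * p s) 0 - a * u s ^ 2
      - holding Ch Cs (traj α β x₀ u p s)) volume 0 T := by
  have hrev : IntegrableOn (fun s => p s * max (α s - β s * p s) 0) (Icc 0 T) := by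
    refine integrableOn_Icc_of_abs_le (g := fun t => α t / β t * α t)
      (h.2.1.aestronglyMeasurable.mul (aestronglyMeasurable_demand h.2.1 hαc hβc))
      ((hαc.div hβc fun t ht => (hβ t ht).ne').mul hαc) fun t ht => ?_
    obtain ⟨-, -, h3, h4⟩ := h.2.2 t ht
    rw [abs_mul, abs_of_nonneg h3]
    exact mul_le_mul h4 (h.demand_abs_le hβ ht) (abs_nonneg _) (h3.trans h4)
  have hcost : IntegrableOn (fun s => u s ^ 2) (Icc 0 T) := by
    refine integrableOn_Icc_of_abs_le (g := fun t => (α t / (2 * a * β t)) ^ 2)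
      (h.1.pow_const 2).aestronglyMeasurable
      ((hαc.div (continuousOn_const.mul hβc) fun t ht =>
        (mul_pos (mul_pos two_pos ha) (hβ t ht)).ne').pow 2) fun t ht => ?_
    rw [abs_of_nonneg (sq_nonneg _)]
    exact pow_le_pow_left₀ (h.2.2 t ht).1 (h.2.2 t ht).2.1 2
  have hhold : IntegrableOn (fun s => holding Ch Cs (traj α β x₀ u p s)) (Icc 0 T) :=
    ((continuous_holding Ch Cs).comp_continuousOn
      (continuousOn_traj h hT ha hαc hβc hβ x₀)).integrableOn_Icc
  rw [intervalIntegrable_iff_integrableOn_Icc_of_le hT.le]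
  exact (hrev.sub (hcost.const_mul a)).sub hhold

end Policy

/-- The price increase by which an underpriced policy with positive production is improved. -/
def priceShift (a α β u p : ℝ) : ℝ :=
  max 0 (min ((a * u + α / (2 * β) - p) / (1 + a * β)) (u / β))

section PriceShift

variable {a α β u p : ℝ}

theorem priceShift_nonneg : 0 ≤ priceShift a α β u p := le_max_left _ _

theorem priceShift_pos (ha : 0 < a) (hβ : 0 < β) (hp : p < a * u + α / (2 * β)) (hu : 0 < u) :
    0 < priceShift a α β u p :=
  lt_max_of_lt_right (lt_min (div_pos (by linarith) (by positivity)) (div_pos hu hβ))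

theorem mul_priceShift_le (hβ : 0 < β) (hu : 0 ≤ u) : β * priceShift a α β u p ≤ u := by
  have h : priceShift a α β u p ≤ u / β := max_le (div_nonneg hu hβ.le) (min_le_right _ _)
  rw [le_div_iff₀ hβ] at h
  linarith

theorem priceShift_eq_zero_or_le (ha : 0 < a) (hβ : 0 < β) :
    priceShift a α β u p = 0 ∨
      (1 + a * β) * priceShift a α β u p ≤ a * u + α / (2 * β) - p := by
  rcases max_choice 0 (min ((a * u + α / (2 * β) - p) / (1 + a * β)) (u / β)) with h | h
  · exact Or.inl h
  · right
    have hle : priceShift a α β u p ≤ (a * u + α / (2 * β) - p) / (1 + a * β) :=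
      h.trans_le (min_le_left _ _)
    rw [le_div_iff₀ (by positivity)] at hle
    linarith

theorem add_priceShift_le (ha : 0 < a) (hβ : 0 < β) (hu : u ≤ α / (2 * a * β))
    (hp : p ≤ α / β) : p + priceShift a α β u p ≤ α / β := by
  rcases priceShift_eq_zero_or_le (a := a) (α := α) (u := u) (p := p) ha hβ with h | h
  · linarith
  · have h1 : a * u ≤ α / (2 * β) := by
      calc a * u ≤ a * (α / (2 * a * β)) := mul_le_mul_of_nonneg_left hu ha.le
        _ = α / (2 * β) := by field_simp
    have h2 : α / (2 * β) + α / (2 * β) = α / β := by field_simp; ring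
    have h3 : 0 ≤ a * β * priceShift a α β u p :=
      mul_nonneg (mul_pos ha hβ).le priceShift_nonneg
    linarith

/-- The gain in running profit dominates a quantity that is positive when the shift is. -/
theorem profit_add_le_profit_priceShift (ha : 0 < a) (hβ : 0 < β) :
    p * (α - β * p) - a * u ^ 2 + β * (1 + a * β) * priceShift a α β u p ^ 2 ≤
      (p + priceShift a α β u p) * (α - β * (p + priceShift a α β u p))
        - a * (u - β * priceShift a α β u p) ^ 2 := by
  rcases priceShift_eq_zero_or_le (a := a) (α := α) (u := u) (p := p) ha hβ with h | h
  · simp [h]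
  · have h0 := priceShift_nonneg (a := a) (α := α) (β := β) (u := u) (p := p)
    generalize priceShift a α β u p = e at h h0 ⊢
    have h1 := mul_le_mul_of_nonneg_left h (mul_nonneg (mul_pos two_pos hβ).le h0)
    have h2 : 2 * β * e * (α / (2 * β)) = e * α := by field_simp
    nlinarith

end PriceShift

/-- strict improvement, underpricing case: if the set where
`p(t) < a u(t) + α(t)/(2β(t))` and `u(t) > 0` has positive measure,
then there is a strictly better policy with the same inventory trajectory. -/
theorem strict_improvement_underpricing
    (T a σ Ch Cs ChT CsT : ℝ)
    (hT : 0 < T) (ha : 0 < a) (hσ : 0 ≤ σ)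
    (hCh : 0 < Ch) (hCs : 0 < Cs) (hChT : 0 < ChT) (hCsT : 0 < CsT)
    (α β : ℝ → ℝ)
    (hαLip : ∃ K : ℝ≥0, LipschitzOnWith K α (Icc 0 T))
    (hβLip : ∃ K : ℝ≥0, LipschitzOnWith K β (Icc 0 T))
    (hα : ∀ t ∈ Icc (0 : ℝ) T, 0 < α t) (hβ : ∀ t ∈ Icc (0 : ℝ) T, 0 < β t)
    (x₀ : ℝ) (u p : ℝ → ℝ) (hmem : memS T a α β u p)
    (hΓ : 0 < volume {t | t ∈ Icc (0 : ℝ) T ∧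
      p t < a * u t + α t / (2 * β t) ∧ 0 < u t}) :
    ∃ utld ptld : ℝ → ℝ, memS T a α β utld ptld ∧
      (∀ t ∈ Icc (0 : ℝ) T, traj α β x₀ utld ptld t = traj α β x₀ u p t) ∧
      Jobj T a σ Ch Cs ChT CsT α β x₀ u p < Jobj T a σ Ch Cs ChT CsT α β x₀ utld ptld := by
  have hαc : ContinuousOn α (Icc 0 T) := hαLip.choose_spec.continuousOn
  have hβc : ContinuousOn β (Icc 0 T) := hβLip.choose_spec.continuousOn
  obtain ⟨A, hA, hAα⟩ : ∃ A : ℝ → ℝ, Measurable A ∧ ∀ t ∈ Icc (0 : ℝ) T, A t = α t :=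
    ⟨IccExtend hT.le (domRestrict (Icc 0 T) α),
      (continuousOn_iff_continuous_domRestrict.1 hαc).Icc_extend'.measurable,
      fun t ht => IccExtend_of_mem hT.le _ ht⟩
  obtain ⟨B, hB, hBβ⟩ : ∃ B : ℝ → ℝ, Measurable B ∧ ∀ t ∈ Icc (0 : ℝ) T, B t = β t :=
    ⟨IccExtend hT.le (domRestrict (Icc 0 T) β),
      (continuousOn_iff_continuous_domRestrict.1 hβc).Icc_extend'.measurable,
      fun t ht => IccExtend_of_mem hT.le _ ht⟩
  have hu := hmem.1
  have hp := hmem.2.1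
  set e : ℝ → ℝ := fun t => priceShift a (A t) (B t) (u t) (p t) with he
  have hem : Measurable e := by
    unfold priceShift at he
    rw [he]
    fun_prop
  have hee : ∀ t ∈ Icc (0 : ℝ) T, e t = priceShift a (α t) (β t) (u t) (p t) := fun t ht => by
    simp only [he, hAα t ht, hBβ t ht]
  have hmem' : memS T a α β (fun t => u t - B t * e t) (fun t => p t + e t) := by
    refine ⟨hu.sub (hB.mul hem), hp.add hem, fun t ht => ?_⟩
    obtain ⟨h1, h2, h3, h4⟩ := hmem.2.2 t ht
    have hb := hβ t ht
    have h5 := priceShift_nonneg (a := a) (α := α t) (β := β t) (u := u t) (p := p t)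
    have h6 := mul_priceShift_le (a := a) (α := α t) (p := p t) hb h1
    have h7 := mul_nonneg hb.le h5
    simp only [hBβ t ht, hee t ht]
    exact ⟨by linarith, by linarith, by linarith, add_priceShift_le ha hb h2 h4⟩
  have htraj : ∀ t ∈ Icc (0 : ℝ) T,
      traj α β x₀ (fun t => u t - B t * e t) (fun t => p t + e t) t = traj α β x₀ u p t := by
    intro t ht
    unfold traj
    congr 1
    refine intervalIntegral.integral_congr fun s hs => ?_
    rw [uIcc_of_le ht.1] at hs
    have hs' : s ∈ Icc (0 : ℝ) T := ⟨hs.1, hs.2.trans ht.2⟩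
    have hd := hmem.demand_nonneg hβ hs'
    have hd' := hmem'.demand_nonneg hβ hs'
    simp only at hd' ⊢
    rw [max_eq_left hd, max_eq_left hd', hBβ s hs']
    ring
  refine ⟨_, _, hmem', htraj, ?_⟩
  have hgain : ∀ t ∈ Icc (0 : ℝ) T,
      p t * max (α t - β t * p t) 0 - a * u t ^ 2 - holding Ch Cs (traj α β x₀ u p t)
        + β t * (1 + a * β t) * e t ^ 2 ≤
      (p t + e t) * max (α t - β t * (p t + e t)) 0 - a * (u t - B t * e t) ^ 2
        - holding Ch Cs
          (traj α β x₀ (fun t => u t - B t * e t) (fun t => p t + e t) t) := by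
    intro t ht
    have hd := hmem.demand_nonneg hβ ht
    have hd' := hmem'.demand_nonneg hβ ht
    rw [htraj t ht, max_eq_left hd, max_eq_left hd', hBβ t ht, hee t ht]
    have := profit_add_le_profit_priceShift (α := α t) (u := u t) (p := p t) ha (hβ t ht)
    linarith
  have hint : (∫ s in (0 : ℝ)..T,
        (p s * max (α s - β s * p s) 0 - a * u s ^ 2 - holding Ch Cs (traj α β x₀ u p s))) <
      ∫ s in (0 : ℝ)..T,
        ((p s + e s) * max (α s - β s * (p s + e s)) 0 - a * (u s - B s * e s) ^ 2
          - holding Ch Cs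
            (traj α β x₀ (fun t => u t - B t * e t) (fun t => p t + e t) s)) := by
    refine intervalIntegral.integral_lt_integral_of_ae_le_of_measure_setOfPred_lt_ne_zero hT.le
      (intervalIntegrable_profit hmem hT ha hαc hβc hβ x₀ Ch Cs)
      (intervalIntegrable_profit hmem' hT ha hαc hβc hβ x₀ Ch Cs) ?_ ?_
    · refine (ae_restrict_iff' measurableSet_Ioc).2 (Filter.Eventually.of_forall fun t ht => ?_)
      have ht' := Ioc_subset_Icc_self ht
      have hb := hβ t ht'
      have : 0 ≤ β t * (1 + a * β t) * e t ^ 2 := by positivity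
      linarith [hgain t ht']
    · rw [restrict_Ioc_eq_restrict_Icc]
      refine (hΓ.trans_le ?_).ne'
      refine le_trans (measure_mono ?_) (Measure.le_restrict_apply _ _)
      rintro t ⟨ht, hpt, hut⟩
      refine ⟨?_, ht⟩
      have hb := hβ t ht
      have hpos : 0 < e t := by
        rw [hee t ht]
        exact priceShift_pos ha hb hpt hut
      have : 0 < β t * (1 + a * β t) * e t ^ 2 := by positivity
      simp only [mem_ofPred_eq]
      linarith [hgain t ht]
  unfold Jobj
  rw [htraj T ⟨hT.le, le_rfl⟩, image_congr htraj]
  linarith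
end
end

section
/- Local decrease of the optimal production rate at negative inventory: assume x₀ ≥ 0 and that there exist an optimal policy u* ∈ S_u for J_σ and a constant η > 0 with η ≤ u*(t) ≤ α(t)/(2aβ(t)) − η for all t. Let x* be the trajectory of u* and define w(t₁,t₂) := ∫_{t₁}^{t₂} u*(s) ds. If t ∈ (0,T) and x*(t) < 0, then there exists δ̄ > 0 such that w(t−δ, t) ≥ w(t, t+δ) for all 0 < δ ≤ δ̄. -/
open MeasureTheory Set
open scoped NNReal

noncomputable section

/-- Membership in the reduced policy space `S_u`. -/
def memSu (T a : ℝ) (α β : ℝ → ℝ) (u : ℝ → ℝ) : Prop :=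
  Measurable u ∧ ∀ t ∈ Icc (0 : ℝ) T, 0 ≤ u t ∧ u t ≤ α t / (2 * a * β t)

/-- Inventory trajectory under production rate `u` (with `γ(t) = 1 + aβ(t)`). -/
def trajU (a : ℝ) (α β : ℝ → ℝ) (x₀ : ℝ) (u : ℝ → ℝ) (t : ℝ) : ℝ :=
  x₀ + ∫ s in (0 : ℝ)..t, (u s * (1 + a * β s) - α s / 2)

/-- The objective `J_σ(u)` over the reduced policy space. -/
def JobjU (T a σ Ch Cs ChT CsT : ℝ) (α β : ℝ → ℝ) (x₀ : ℝ) (u : ℝ → ℝ) : ℝ :=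
  (∫ s in (0 : ℝ)..T,
    (-(a * u s ^ 2 * (1 + a * β s)) + α s ^ 2 / (4 * β s)
      - holding Ch Cs (trajU a α β x₀ u s)))
  - holding ChT CsT (trajU a α β x₀ u T)
  - σ * sSup (trajU a α β x₀ u '' Icc 0 T)

theorem holding_le_of_neg {Ch Cs x y : ℝ} (hCs : 0 ≤ Cs) (hxy : x ≤ y) (hy : y < 0) :
    holding Ch Cs y ≤ holding Ch Cs x := by
  rw [holding, holding, if_pos hy, if_pos (hxy.trans_lt hy)]
  exact mul_le_mul_of_nonneg_left (by nlinarith) hCs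

section Policy

variable {T a : ℝ} {α β u : ℝ → ℝ}

theorem continuousOn_maxRate (ha : 0 < a) (hα : ContinuousOn α (Icc 0 T))
    (hβ : ContinuousOn β (Icc 0 T)) (hβpos : ∀ t ∈ Icc (0 : ℝ) T, 0 < β t) :
    ContinuousOn (fun t => α t / (2 * a * β t)) (Icc 0 T) :=
  hα.div (continuousOn_const.mul hβ) fun t ht => by
    have := hβpos t ht
    positivity

theorem memSu.intervalIntegrable_pow (hT : 0 ≤ T) (ha : 0 < a) (hα : ContinuousOn α (Icc 0 T))
    (hβ : ContinuousOn β (Icc 0 T)) (hβpos : ∀ t ∈ Icc (0 : ℝ) T, 0 < β t)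
    (hu : memSu T a α β u) (n : ℕ) :
    IntervalIntegrable (fun s => u s ^ n) volume 0 T := by
  have hg : IntervalIntegrable (fun t => (α t / (2 * a * β t)) ^ n) volume 0 T := by
    apply ContinuousOn.intervalIntegrable
    rw [uIcc_of_le hT]
    exact (continuousOn_maxRate ha hα hβ hβpos).pow n
  refine hg.mono_fun (hu.1.pow_const n).aestronglyMeasurable ?_
  rw [uIoc_of_le hT]
  filter_upwards [ae_restrict_mem measurableSet_Ioc] with s hs
  obtain ⟨h0, h1⟩ := hu.2 s (Ioc_subset_Icc_self hs)
  rw [Real.norm_of_nonneg (pow_nonneg h0 n), Real.norm_of_nonneg (pow_nonneg (h0.trans h1) n)]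
  exact pow_le_pow_left₀ h0 h1 n

theorem memSu.intervalIntegrable_drift (hT : 0 ≤ T) (ha : 0 < a) (hα : ContinuousOn α (Icc 0 T))
    (hβ : ContinuousOn β (Icc 0 T)) (hβpos : ∀ t ∈ Icc (0 : ℝ) T, 0 < β t)
    (hu : memSu T a α β u) :
    IntervalIntegrable (fun s => u s * (1 + a * β s) - α s / 2) volume 0 T := by
  have h1 : IntervalIntegrable u volume 0 T := by
    simpa using hu.intervalIntegrable_pow hT ha hα hβ hβpos 1
  rw [← uIcc_of_le hT] at hα hβ
  exact (h1.mul_continuousOn (continuousOn_const.add (continuousOn_const.mul hβ))).sub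
    (hα.div_const 2).intervalIntegrable

theorem memSu.continuousOn_trajU (hT : 0 ≤ T) (ha : 0 < a) (hα : ContinuousOn α (Icc 0 T))
    (hβ : ContinuousOn β (Icc 0 T)) (hβpos : ∀ t ∈ Icc (0 : ℝ) T, 0 < β t)
    (hu : memSu T a α β u) (x₀ : ℝ) :
    ContinuousOn (trajU a α β x₀ u) (Icc 0 T) := by
  have h := (intervalIntegrable_iff' (μ := volume)).1
    (hu.intervalIntegrable_drift hT ha hα hβ hβpos)
  have := intervalIntegral.continuousOn_primitive_interval h
  rw [uIcc_of_le hT] at this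
  exact continuousOn_const.add this

theorem memSu.intervalIntegrable_runningProfit (hT : 0 ≤ T) (ha : 0 < a)
    (hα : ContinuousOn α (Icc 0 T)) (hβ : ContinuousOn β (Icc 0 T))
    (hβpos : ∀ t ∈ Icc (0 : ℝ) T, 0 < β t) (hu : memSu T a α β u) (Ch Cs x₀ : ℝ) :
    IntervalIntegrable (fun s => -(a * u s ^ 2 * (1 + a * β s)) + α s ^ 2 / (4 * β s)
      - holding Ch Cs (trajU a α β x₀ u s)) volume 0 T := by
  have h2 := hu.intervalIntegrable_pow hT ha hα hβ hβpos 2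
  have hx := (continuous_holding Ch Cs).comp_continuousOn
    (hu.continuousOn_trajU hT ha hα hβ hβpos x₀)
  have hq : ContinuousOn (fun s => α s ^ 2 / (4 * β s)) (Icc 0 T) :=
    (hα.pow 2).div (continuousOn_const.mul hβ) fun t ht => by
      have := hβpos t ht
      positivity
  rw [← uIcc_of_le hT] at hβ hx hq
  exact (((h2.const_mul a).mul_continuousOn
    (continuousOn_const.add (continuousOn_const.mul hβ))).neg.add
    hq.intervalIntegrable).sub hx.intervalIntegrable

end Policy

/-- The step function equal to `1` on `(t - δ, t]`, to `-1` on `(t, t + δ]` and to `0`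
elsewhere. -/
def exchangeStep (t δ : ℝ) : ℝ → ℝ :=
  (Ioc (t - δ) t).indicator 1 - (Ioc t (t + δ)).indicator 1

section ExchangeStep

variable {t δ T s : ℝ}

theorem measurable_exchangeStep (t δ : ℝ) : Measurable (exchangeStep t δ) :=
  (measurable_one.indicator measurableSet_Ioc).sub (measurable_one.indicator measurableSet_Ioc)

theorem abs_exchangeStep_le_one (t δ s : ℝ) : |exchangeStep t δ s| ≤ 1 := by
  simp only [exchangeStep, Pi.sub_apply, indicator_apply, Pi.one_apply, mem_Ioc]
  split_ifs with h1 h2 <;> norm_num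

theorem intervalIntegrable_mul_exchangeStep {f : ℝ → ℝ} {a b : ℝ}
    (hf : IntervalIntegrable f volume a b) (t δ : ℝ) :
    IntervalIntegrable (fun r => f r * exchangeStep t δ r) volume a b := by
  refine hf.mono_fun (hf.aestronglyMeasurable_restrict_uIoc.mul
    (measurable_exchangeStep t δ).aestronglyMeasurable) (Filter.Eventually.of_forall fun r => ?_)
  simp only [norm_mul, Real.norm_eq_abs]
  exact mul_le_of_le_one_right (abs_nonneg _) (abs_exchangeStep_le_one t δ r)

theorem integral_mul_exchangeStep {f : ℝ → ℝ} (hδ : 0 ≤ δ) (h0 : 0 ≤ t - δ) (hT : t + δ ≤ T)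
    (hf : IntervalIntegrable f volume 0 T) :
    ∫ r in (0 : ℝ)..T, f r * exchangeStep t δ r =
      (∫ r in (t - δ)..t, f r) - ∫ r in t..(t + δ), f r := by
  have hf' := (intervalIntegrable_iff_integrableOn_Ioc_of_le (by linarith)).1 hf
  have key : ∀ r, f r * exchangeStep t δ r =
      (Ioc (t - δ) t).indicator f r - (Ioc t (t + δ)).indicator f r := by
    intro r
    simp only [exchangeStep, Pi.sub_apply, indicator_apply, Pi.one_apply]
    split_ifs <;> ring
  simp only [key]
  rw [intervalIntegral.integral_of_le (by linarith), intervalIntegral.integral_of_le (by linarith),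
    intervalIntegral.integral_of_le (by linarith),
    integral_sub (hf'.indicator measurableSet_Ioc) (hf'.indicator measurableSet_Ioc),
    setIntegral_indicator measurableSet_Ioc, setIntegral_indicator measurableSet_Ioc,
    inter_eq_right.2 (Ioc_subset_Ioc h0 (by linarith)),
    inter_eq_right.2 (Ioc_subset_Ioc (by linarith) hT)]

theorem integral_exchangeStep (hδ : 0 ≤ δ) (h0 : 0 ≤ t - δ) (hs : 0 ≤ s) :
    ∫ r in (0 : ℝ)..s, exchangeStep t δ r = max 0 (δ - |s - t|) := by
  have hi : ∀ p q : ℝ, IntegrableOn ((Ioc p q).indicator (1 : ℝ → ℝ)) (Ioc 0 s) volume :=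
    fun p q => (integrableOn_const (by simp)).indicator measurableSet_Ioc
  simp only [exchangeStep, Pi.sub_apply]
  rw [intervalIntegral.integral_of_le hs, integral_sub (hi _ _) (hi _ _),
    setIntegral_indicator measurableSet_Ioc, setIntegral_indicator measurableSet_Ioc]
  simp only [Ioc_inter_Ioc, Pi.one_apply, integral_const, smul_eq_mul, mul_one,
    measureReal_restrict_apply_univ, Real.volume_real_Ioc]
  rw [max_eq_right h0, max_eq_right (by linarith : 0 ≤ t)]
  rcases abs_cases (s - t) with ⟨h, _⟩ | ⟨h, _⟩ <;> rw [h] <;>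
  rcases min_cases s t with ⟨h, _⟩ | ⟨h, _⟩ <;> rw [h] <;>
  rcases min_cases s (t + δ) with ⟨h, _⟩ | ⟨h, _⟩ <;> rw [h] <;>
  simp only [max_def] <;> split_ifs <;> linarith

end ExchangeStep

/-- at interior times of strictly negative inventory, the optimal
production rate locally decreases, in the integrated sense
`∫_{t-δ}^t u* ≥ ∫_t^{t+δ} u*` for all small `δ > 0`. -/
theorem optimal_rate_locally_decreasing_at_negative_inventory
    (T a σ Ch Cs ChT CsT : ℝ)
    (hT : 0 < T) (ha : 0 < a) (hσ : 0 ≤ σ)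
    (hCh : 0 < Ch) (hCs : 0 < Cs) (hChT : 0 < ChT) (hCsT : 0 < CsT)
    (α β : ℝ → ℝ)
    (hαLip : ∃ K : ℝ≥0, LipschitzOnWith K α (Icc 0 T))
    (hβLip : ∃ K : ℝ≥0, LipschitzOnWith K β (Icc 0 T))
    (hα : ∀ t ∈ Icc (0 : ℝ) T, 0 < α t) (hβ : ∀ t ∈ Icc (0 : ℝ) T, 0 < β t)
    (x₀ : ℝ) (hx₀ : 0 ≤ x₀)
    (ustar : ℝ → ℝ) (hmem : memSu T a α β ustar)
    (hint : ∃ η > (0 : ℝ), ∀ t ∈ Icc (0 : ℝ) T,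
      η ≤ ustar t ∧ ustar t ≤ α t / (2 * a * β t) - η)
    (hopt : ∀ u : ℝ → ℝ, memSu T a α β u →
      JobjU T a σ Ch Cs ChT CsT α β x₀ u ≤ JobjU T a σ Ch Cs ChT CsT α β x₀ ustar)
    (t : ℝ) (ht : t ∈ Ioo (0 : ℝ) T) (hneg : trajU a α β x₀ ustar t < 0) :
    ∃ δbar > (0 : ℝ), ∀ δ : ℝ, 0 < δ → δ ≤ δbar →
      (∫ s in t..(t + δ), ustar s) ≤ ∫ s in (t - δ)..t, ustar s := by
  have hαc : ContinuousOn α (Icc 0 T) := hαLip.choose_spec.continuousOn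
  have hβc : ContinuousOn β (Icc 0 T) := hβLip.choose_spec.continuousOn
  have hT0 := hT.le
  obtain ⟨ht0, htT⟩ := ht
  obtain ⟨η, hη, hint⟩ := hint
  have hxc := hmem.continuousOn_trajU hT0 ha hαc hβc hβ x₀
  obtain ⟨m, hm, hxm⟩ : ∃ m > 0, trajU a α β x₀ ustar t < -m :=
    ⟨-trajU a α β x₀ ustar t / 2, by linarith, by linarith⟩
  have hev : ∀ᶠ s in nhds t, (s ∈ Icc 0 T) ∧ trajU a α β x₀ ustar s < -m :=
    Filter.Eventually.and (Icc_mem_nhds ht0 htT)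
      ((hxc.continuousAt (Icc_mem_nhds ht0 htT)).eventually_lt_const hxm)
  obtain ⟨d, hd, hball⟩ := Metric.nhds_basis_closedBall.eventually_iff.1 hev
  refine ⟨d, hd, fun δ hδ hδd => ?_⟩
  have hnear : ∀ s, |s - t| ≤ δ → s ∈ Icc 0 T ∧ trajU a α β x₀ ustar s < -m :=
    fun s hs => hball (by rw [Metric.mem_closedBall, Real.dist_eq]; exact hs.trans hδd)
  have hl : 0 ≤ t - δ := (hnear (t - δ) (by simp [abs_of_pos hδ])).1.1
  have hr : t + δ ≤ T := (hnear (t + δ) (by simp [abs_of_pos hδ])).1.2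
  have hui : IntervalIntegrable ustar volume 0 T := by
    simpa using hmem.intervalIntegrable_pow hT0 ha hαc hβc hβ 1
  suffices H : ∀ ε > 0, ε ≤ η → ε * δ ≤ m →
      0 ≤ 2 * ((∫ s in (t - δ)..t, ustar s) - ∫ s in t..(t + δ), ustar s) + ε * T by
    by_contra! hlt
    set D := (∫ s in t..(t + δ), ustar s) - ∫ s in (t - δ)..t, ustar s with hD
    have hDpos : 0 < D := sub_pos.2 hlt
    have hε : 0 < min η (min (m / δ) (D / T)) := by positivity
    have h1 : min η (min (m / δ) (D / T)) ≤ m / δ := (min_le_right _ _).trans (min_le_left _ _)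
    have h2 : min η (min (m / δ) (D / T)) ≤ D / T := (min_le_right _ _).trans (min_le_right _ _)
    have := H _ hε (min_le_left _ _) ((le_div_iff₀ hδ).1 h1)
    have := (le_div_iff₀ hT).1 h2
    linarith
  intro ε hε hεη hεm
  obtain ⟨K, hK⟩ := hβLip
  obtain ⟨β', hβ'K, hββ'⟩ := hK.extend_real
  set v := exchangeStep t δ with hv
  set u : ℝ → ℝ := fun s => ustar s + ε * (v s / (1 + a * β' s)) with hu
  have hγ : ∀ s ∈ Icc (0 : ℝ) T, 1 ≤ 1 + a * β s := fun s hs => by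
    have := hβ s hs
    have : 0 < a * β s := by positivity
    linarith
  have huv : ∀ s ∈ Icc (0 : ℝ) T, u s = ustar s + ε * (v s / (1 + a * β s)) := fun s hs => by
    simp only [hu, hββ' hs]
  have hvabs : ∀ s, |v s| ≤ 1 := abs_exchangeStep_le_one t δ
  have humem : memSu T a α β u := by
    constructor
    · have hβ'm := hβ'K.continuous.measurable
      exact hmem.1.add (((measurable_exchangeStep t δ).div
        ((hβ'm.const_mul a).const_add 1)).const_mul ε)
    · intro s hs
      have hq : |ε * (v s / (1 + a * β s))| ≤ η := by
        have h1 := hγ s hs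
        rw [abs_mul, abs_div, abs_of_pos hε, abs_of_pos (by linarith : 0 < 1 + a * β s)]
        have : |v s| / (1 + a * β s) ≤ 1 := by
          rw [div_le_one (by linarith)]
          exact (hvabs s).trans h1
        exact (mul_le_of_le_one_right hε.le this).trans hεη
      obtain ⟨h1, h2⟩ := abs_le.1 hq
      obtain ⟨h3, h4⟩ := hint s hs
      rw [huv s hs]
      constructor <;> linarith
  have htraj : ∀ s ∈ Icc (0 : ℝ) T,
      trajU a α β x₀ u s = trajU a α β x₀ ustar s + ε * max 0 (δ - |s - t|) := by
    intro s hs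
    have hdrift : IntervalIntegrable (fun r => ustar r * (1 + a * β r) - α r / 2) volume 0 s :=
      (hmem.intervalIntegrable_drift hT0 ha hαc hβc hβ).mono_set
        (by rw [uIcc_of_le hs.1, uIcc_of_le hT0]; exact Icc_subset_Icc_right hs.2)
    have hvi : IntervalIntegrable v volume 0 s := by
      simpa using intervalIntegrable_mul_exchangeStep
        (intervalIntegrable_const (c := (1 : ℝ)) (μ := volume) (a := 0) (b := s)) t δ
    rw [← integral_exchangeStep hδ.le hl hs.1, ← intervalIntegral.integral_const_mul, trajU, trajU,
      add_assoc, ← intervalIntegral.integral_add hdrift (hvi.const_mul ε)]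
    congr 1
    refine intervalIntegral.integral_congr fun r hr => ?_
    rw [uIcc_of_le hs.1] at hr
    have hr' : r ∈ Icc 0 T := ⟨hr.1, hr.2.trans hs.2⟩
    have hne : 1 + a * β r ≠ 0 := by linarith [hγ r hr']
    simp only [huv r hr']
    field_simp
    ring
  have hcases : ∀ s ∈ Icc (0 : ℝ) T, trajU a α β x₀ u s = trajU a α β x₀ ustar s ∨
      (trajU a α β x₀ ustar s ≤ trajU a α β x₀ u s ∧ trajU a α β x₀ u s < 0) := by
    intro s hs
    rw [htraj s hs]
    rcases le_or_gt δ |s - t| with h | h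
    · left
      rw [max_eq_left (by linarith), mul_zero, add_zero]
    · right
      rw [max_eq_right (by linarith)]
      have h1 := (hnear s h.le).2
      have h2 : 0 ≤ ε * (δ - |s - t|) := mul_nonneg hε.le (by linarith)
      have h3 : ε * (δ - |s - t|) ≤ ε * δ :=
        mul_le_mul_of_nonneg_left (by linarith [abs_nonneg (s - t)]) hε.le
      constructor <;> linarith
  have hsup : sSup (trajU a α β x₀ u '' Icc 0 T) ≤ sSup (trajU a α β x₀ ustar '' Icc 0 T) := by
    have hbdd : BddAbove (trajU a α β x₀ ustar '' Icc 0 T) :=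
      (isCompact_Icc.image_of_continuousOn hxc).bddAbove
    refine csSup_le ((nonempty_Icc.2 hT0).image _) ?_
    rintro _ ⟨s, hs, rfl⟩
    rcases hcases s hs with h | ⟨-, h⟩
    · rw [h]
      exact le_csSup hbdd ⟨s, hs, rfl⟩
    · have h0 : x₀ ≤ sSup (trajU a α β x₀ ustar '' Icc 0 T) :=
        le_csSup hbdd ⟨0, left_mem_Icc.2 hT0, by simp [trajU]⟩
      linarith
  have hend : trajU a α β x₀ u T = trajU a α β x₀ ustar T := by
    rw [htraj T (right_mem_Icc.2 hT0), max_eq_left, mul_zero, add_zero]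
    linarith [le_abs_self (T - t)]
  have hJ := hopt u humem
  have hσsup := mul_le_mul_of_nonneg_left hsup hσ
  have hFi := hmem.intervalIntegrable_runningProfit hT0 ha hαc hβc hβ Ch Cs x₀
  have hvi : IntervalIntegrable (fun s => 2 * a * ε * (ustar s * v s) + a * ε ^ 2) volume 0 T :=
    ((intervalIntegrable_mul_exchangeStep hui t δ).const_mul _).add intervalIntegrable_const
  have hmono := intervalIntegral.integral_mono_on hT0 (hFi.sub hvi)
    (humem.intervalIntegrable_runningProfit hT0 ha hαc hβc hβ Ch Cs x₀) (fun s hs => by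
      have hh : holding Ch Cs (trajU a α β x₀ u s) ≤ holding Ch Cs (trajU a α β x₀ ustar s) := by
        rcases hcases s hs with h | ⟨h, h'⟩
        · rw [h]
        · exact holding_le_of_neg hCs.le h h'
      have h1 := hγ s hs
      have hpos : 0 < 1 + a * β s := by linarith
      have hsq : v s ^ 2 / (1 + a * β s) ≤ 1 := by
        rw [div_le_one hpos]
        exact ((sq_le_one_iff_abs_le_one _).2 (hvabs s)).trans h1
      have hexp : a * u s ^ 2 * (1 + a * β s) = a * ustar s ^ 2 * (1 + a * β s)
          + 2 * a * ε * (ustar s * v s) + a * ε ^ 2 * (v s ^ 2 / (1 + a * β s)) := by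
        rw [huv s hs]
        field_simp
        ring
      have h2 : a * ε ^ 2 * (v s ^ 2 / (1 + a * β s)) ≤ a * ε ^ 2 :=
        mul_le_of_le_one_right (by positivity) hsq
      linarith)
  rw [intervalIntegral.integral_sub hFi hvi, intervalIntegral.integral_add
    ((intervalIntegrable_mul_exchangeStep hui t δ).const_mul _) intervalIntegrable_const,
    intervalIntegral.integral_const_mul, integral_mul_exchangeStep hδ.le hl hr hui,
    intervalIntegral.integral_const, smul_eq_mul, sub_zero] at hmono
  simp only [JobjU, hend] at hJ
  refine nonneg_of_mul_nonneg_right (a := a * ε) ?_ (by positivity)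
  linarith
end
end

section
/- Existence of an optimal service-rate policy for the smoothed queueing problem with peak-congestion cost: for every initial condition (x₀, y₀) ∈ ℝ² with x₀ ≤ y₀, there exists an admissible control u* : [0,T] → [0,ū] such that Q(u*) ≥ Q(u) for every admissible control u; i.e. the supremum of Q over admissible controls is attained. -/
open MeasureTheory Set
open scoped NNReal

noncomputable section

/-- The piecewise-linear smoothing function ψ_δ. -/
def psiδ (δ d : ℝ) : ℝ := if d < -δ then 0 else if d ≤ 0 then 1 + d / δ else 1

/-- Admissible service-rate control: measurable with values in `[0, ubar]`. -/
def AdmissibleQ (ubar : ℝ) (u : ℝ → ℝ) : Prop :=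
  Measurable u ∧ ∀ t, u t ∈ Icc (0 : ℝ) ubar

/-- The state `(x, y)` of the smoothed queueing system under control `u`,
with initial condition `(x₀, y₀)`. -/
def IsStateQ (T δ : ℝ) (α : ℝ → ℝ) (u : ℝ → ℝ) (x₀ y₀ : ℝ)
    (x y : ℝ → ℝ) : Prop :=
  ContinuousOn x (Icc 0 T) ∧ ContinuousOn y (Icc 0 T) ∧
  ∀ t ∈ Icc (0 : ℝ) T,
    x t = x₀ + (∫ s in (0 : ℝ)..t, (α s - (α s + x s) * u s)) ∧
    y t = y₀ + (∫ s in (0 : ℝ)..t,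
      max (α s - (α s + x s) * u s) 0 * psiδ δ (x s - y s))

/-- The queueing objective `Q(u)` evaluated along the state `(x, y)`. -/
def Qobj (T σ ρ β η μid : ℝ) (α : ℝ → ℝ) (u x y : ℝ → ℝ) : ℝ :=
  -(∫ t in (0 : ℝ)..T, (ρ * x t + β * ((α t + x t) * u t - μid) ^ 2))
  - η * x T - σ * y T

theorem psiδ_eq {δ : ℝ} (hδ : 0 < δ) (d : ℝ) : psiδ δ d = max 0 (min 1 (1 + d / δ)) := by
  unfold psiδ
  split_ifs with h1 h2
  · have : d / δ < -1 := by rw [div_lt_iff₀ hδ]; linarith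
    rw [max_eq_left]
    exact (min_le_right _ _).trans (by linarith)
  · have h3 : d / δ ≤ 0 := div_nonpos_of_nonpos_of_nonneg h2 hδ.le
    have h4 : -1 ≤ d / δ := by rw [le_div_iff₀ hδ]; linarith
    rw [min_eq_right (by linarith), max_eq_right (by linarith)]
  · have h3 : 0 < d / δ := div_pos (not_le.mp h2) hδ
    rw [min_eq_left (by linarith), max_eq_right zero_le_one]

theorem psiδ_nonneg {δ : ℝ} (hδ : 0 < δ) (d : ℝ) : 0 ≤ psiδ δ d := by
  rw [psiδ_eq hδ]; exact le_max_left _ _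

theorem psiδ_le_one {δ : ℝ} (hδ : 0 < δ) (d : ℝ) : psiδ δ d ≤ 1 := by
  rw [psiδ_eq hδ]; exact max_le zero_le_one (min_le_left _ _)

theorem psiδ_monotone {δ : ℝ} (hδ : 0 < δ) : Monotone (psiδ δ) := by
  intro a b h
  rw [psiδ_eq hδ, psiδ_eq hδ]
  gcongr

theorem continuous_psiδ {δ : ℝ} (hδ : 0 < δ) : Continuous (psiδ δ) := by
  rw [funext (psiδ_eq hδ)]
  fun_prop

theorem abs_psiδ_sub_le {δ : ℝ} (hδ : 0 < δ) (a b : ℝ) :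
    |psiδ δ a - psiδ δ b| ≤ |a - b| / δ := by
  rw [psiδ_eq hδ, psiδ_eq hδ]
  calc |max 0 (min 1 (1 + a / δ)) - max 0 (min 1 (1 + b / δ))|
      ≤ |min 1 (1 + a / δ) - min 1 (1 + b / δ)| := by
        simpa [max_comm] using abs_max_sub_max_le_abs (min 1 (1 + a / δ)) (min 1 (1 + b / δ)) 0
    _ ≤ |(1 + a / δ) - (1 + b / δ)| := by
        simpa using abs_min_sub_min_le_max 1 (1 + a / δ) 1 (1 + b / δ)
    _ = |a - b| / δ := by
        rw [add_sub_add_left_eq_sub, ← sub_div, abs_div, abs_of_pos hδ]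

theorem intervalIntegrable_of_measurable_of_abs_le {f : ℝ → ℝ} {C : ℝ} (hf : Measurable f)
    (hC : ∀ t, |f t| ≤ C) (a b : ℝ) : IntervalIntegrable f volume a b :=
  (intervalIntegrable_const (c := C)).mono_fun hf.aestronglyMeasurable
    (.of_forall fun t => by
      change |f t| ≤ |C|
      exact (hC t).trans (le_abs_self C))

/-- The peak-congestion equation has a solution for a bounded measurable rate `a`: the integral
operator is a contraction for an exponentially weighted norm. -/
theorem exists_peak_solution {T δ V : ℝ} (hT : 0 ≤ T) (hδ : 0 < δ) {a X : ℝ → ℝ}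
    (ha : Measurable a) (haV : ∀ t, |a t| ≤ V) (hX : Continuous X) (y₀ : ℝ) :
    ∃ y : ℝ → ℝ, Continuous y ∧ ∀ t ∈ Icc (0 : ℝ) T,
      y t = y₀ + ∫ s in (0 : ℝ)..t, a s * psiδ δ (X s - y s) := by
  have hV : 0 ≤ V := (abs_nonneg _).trans (haV 0)
  set L : ℝ := 2 * (V / δ) + 1 with hL
  have hVδ : 0 ≤ V / δ := by positivity
  have hL0 : 0 < L := by positivity
  have hext : ∀ z : C(Icc (0 : ℝ) T, ℝ), Continuous fun s =>
      Real.exp (L * s) * z (projIcc 0 T hT s) :=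
    fun z => (by fun_prop : Continuous fun s => Real.exp (L * s)).mul
      (z.continuous.comp continuous_projIcc)
  have hint : ∀ (z : C(Icc (0 : ℝ) T, ℝ)) (p q : ℝ), IntervalIntegrable
      (fun s => a s * psiδ δ (X s - Real.exp (L * s) * z (projIcc 0 T hT s))) volume p q := by
    intro z
    apply intervalIntegrable_of_measurable_of_abs_le (C := V)
    · exact ha.mul ((continuous_psiδ hδ).comp (hX.sub (hext z))).measurable
    · intro t
      rw [abs_mul, abs_of_nonneg (psiδ_nonneg hδ _)]
      exact (mul_le_mul (haV t) (psiδ_le_one hδ _) (psiδ_nonneg hδ _) hV).trans (by simp)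
  let F : C(Icc (0 : ℝ) T, ℝ) → C(Icc (0 : ℝ) T, ℝ) := fun z =>
    { toFun := fun t => Real.exp (-(L * t)) * (y₀ + ∫ s in (0 : ℝ)..t,
        a s * psiδ δ (X s - Real.exp (L * s) * z (projIcc 0 T hT s)))
      continuous_toFun := by
        have := (intervalIntegral.continuous_primitive (hint z) 0).comp
          (continuous_subtype_val (p := (· ∈ Icc (0 : ℝ) T)))
        exact (by fun_prop : Continuous fun t : Icc (0 : ℝ) T => Real.exp (-(L * t))).mul
          (continuous_const.add this) }
  have hF : ContractingWith (1 / 2) F := by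
    refine ⟨by norm_num, LipschitzWith.of_dist_le_mul fun z w => ?_⟩
    rw [ContinuousMap.dist_le (by positivity)]
    rintro ⟨t, ht⟩
    set D := dist z w
    have hD : 0 ≤ D := dist_nonneg
    have hder : ∀ s : ℝ, HasDerivAt (fun s => V / δ * D / L * Real.exp (L * s))
        (V / δ * D * Real.exp (L * s)) s := by
      intro s
      refine ((((hasDerivAt_id' s).const_mul L).exp).const_mul (V / δ * D / L)).congr_deriv ?_
      field_simp
    have hcont : Continuous fun s => V / δ * D * Real.exp (L * s) := by fun_prop
    have hI : ∫ s in (0 : ℝ)..t, V / δ * D * Real.exp (L * s)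
        = V / δ * D / L * Real.exp (L * t) - V / δ * D / L := by
      rw [intervalIntegral.integral_eq_sub_of_hasDerivAt (fun s _ => hder s)
        (hcont.intervalIntegrable _ _)]
      simp
    have hdiff : ‖∫ s in (0 : ℝ)..t,
        (a s * psiδ δ (X s - Real.exp (L * s) * z (projIcc 0 T hT s))
          - a s * psiδ δ (X s - Real.exp (L * s) * w (projIcc 0 T hT s)))‖
        ≤ ∫ s in (0 : ℝ)..t, V / δ * D * Real.exp (L * s) := by
      refine intervalIntegral.norm_integral_le_of_norm_le ht.1 (.of_forall fun s _ => ?_)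
        (hcont.intervalIntegrable _ _)
      rw [← mul_sub, Real.norm_eq_abs, abs_mul]
      have h1 := abs_psiδ_sub_le hδ (X s - Real.exp (L * s) * z (projIcc 0 T hT s))
        (X s - Real.exp (L * s) * w (projIcc 0 T hT s))
      have h2 : |z (projIcc 0 T hT s) - w (projIcc 0 T hT s)| ≤ D := by
        rw [← Real.dist_eq]; exact ContinuousMap.dist_apply_le_dist _
      have h3 : (X s - Real.exp (L * s) * z (projIcc 0 T hT s))
          - (X s - Real.exp (L * s) * w (projIcc 0 T hT s))
          = -(Real.exp (L * s) * (z (projIcc 0 T hT s) - w (projIcc 0 T hT s))) := by ring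
      rw [h3, abs_neg, abs_mul, abs_of_pos (Real.exp_pos _)] at h1
      calc _ ≤ V * (Real.exp (L * s) * D / δ) := by
            refine mul_le_mul (haV s) (h1.trans ?_) (abs_nonneg _) hV
            gcongr
        _ = V / δ * D * Real.exp (L * s) := by ring
    rw [intervalIntegral.integral_sub (hint z _ _) (hint w _ _), hI] at hdiff
    rw [Real.dist_eq]
    change |Real.exp (-(L * t)) * (y₀ + _) - Real.exp (-(L * t)) * (y₀ + _)| ≤ _
    rw [← mul_sub, add_sub_add_left_eq_sub, abs_mul, abs_of_pos (Real.exp_pos _)]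
    rw [Real.norm_eq_abs] at hdiff
    have hVL : V / δ * D / L ≤ 1 / 2 * D := by
      rw [div_le_iff₀ hL0, hL]; nlinarith
    calc _ ≤ Real.exp (-(L * t)) * (1 / 2 * D * Real.exp (L * t)) := by
          refine mul_le_mul_of_nonneg_left (hdiff.trans ?_) (Real.exp_pos _).le
          have : 0 ≤ V / δ * D / L := by positivity
          have := mul_le_mul_of_nonneg_right hVL (Real.exp_pos (L * t)).le
          linarith
      _ = 1 / 2 * D * (Real.exp (-(L * t)) * Real.exp (L * t)) := by ring
      _ = _ := by rw [← Real.exp_add]; simp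
  obtain ⟨z, hz⟩ : ∃ z, F z = z := ⟨_, hF.fixedPoint_isFixedPt⟩
  refine ⟨fun s => Real.exp (L * s) * z (projIcc 0 T hT s), hext z, fun t ht => ?_⟩
  have h := congrArg (fun f : C(Icc (0 : ℝ) T, ℝ) => f ⟨t, ht⟩) hz
  dsimp only [F, ContinuousMap.coe_mk] at h
  dsimp only
  rw [projIcc_of_mem hT ht, ← h, ← mul_assoc, ← Real.exp_add]
  simp

/-- A priori bound for the queue length. -/
theorem exists_state_bound {T A U : ℝ} (hT : 0 ≤ T) (hU : 0 < U) (hA : 0 ≤ A) (x₀ : ℝ) :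
    ∃ M : ℝ, 0 ≤ M ∧ ∀ α u x : ℝ → ℝ, Continuous α → (∀ t, |α t| ≤ A) → AdmissibleQ U u →
      Continuous x →
      (∀ t ∈ Icc (0 : ℝ) T, x t = x₀ + ∫ s in (0 : ℝ)..t, (α s - (α s + x s) * u s)) →
      ∀ t ∈ Icc (0 : ℝ) T, |x t| ≤ M := by
  set c := |x₀| + A * (1 + U) * T with hc
  have hc0 : 0 ≤ c := by positivity
  have hg0 : 0 ≤ gronwallBound 0 U c T := by
    have := gronwallBound_mono le_rfl hc0 hU.le hT
    rwa [gronwallBound_x0] at this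
  refine ⟨c + U * gronwallBound 0 U c T, by positivity, ?_⟩
  intro α u x hα hαA hu hx hstate
  have hG : ∀ t, HasDerivAt (fun t => ∫ s in (0 : ℝ)..t, |x s|) |x t| t := fun t =>
    hx.abs.integral_hasStrictDerivAt 0 t |>.hasDerivAt
  have hG0 : ∀ t, 0 ≤ t → 0 ≤ ∫ s in (0 : ℝ)..t, |x s| := fun t ht =>
    intervalIntegral.integral_nonneg ht fun s _ => abs_nonneg _
  have key : ∀ t ∈ Icc (0 : ℝ) T, |x t| ≤ c + U * ∫ s in (0 : ℝ)..t, |x s| := by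
    intro t ht
    have hcont : Continuous fun s => A * (1 + U) + U * |x s| := by fun_prop
    have h1 : ‖∫ s in (0 : ℝ)..t, (α s - (α s + x s) * u s)‖
        ≤ ∫ s in (0 : ℝ)..t, (A * (1 + U) + U * |x s|) := by
      refine intervalIntegral.norm_integral_le_of_norm_le ht.1 (.of_forall fun s _ => ?_)
        (hcont.intervalIntegrable _ _)
      obtain ⟨hu0, hu1⟩ := hu.2 s
      calc ‖α s - (α s + x s) * u s‖ = |α s + (-(α s * u s) + -(x s * u s))| := by
            rw [Real.norm_eq_abs]; ring_nf
        _ ≤ |α s| + (|α s| * u s + |x s| * u s) := by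
            refine (abs_add_le _ _).trans (add_le_add_right ((abs_add_le _ _).trans ?_) _)
            rw [abs_neg, abs_neg, abs_mul, abs_mul, abs_of_nonneg hu0]
        _ ≤ A + (A * U + |x s| * U) := by
            gcongr <;> exact hαA s
        _ = _ := by ring
    rw [intervalIntegral.integral_add (by simp)
      ((by fun_prop : Continuous fun s => U * |x s|).intervalIntegrable _ _),
      intervalIntegral.integral_const, intervalIntegral.integral_const_mul, Real.norm_eq_abs] at h1
    rw [hstate t ht]
    refine (abs_add_le _ _).trans ?_
    have : (t - 0) • (A * (1 + U)) ≤ A * (1 + U) * T := by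
      rw [smul_eq_mul, sub_zero, mul_comm]
      exact mul_le_mul_of_nonneg_left ht.2 (by positivity)
    linarith
  intro t ht
  have hgr := norm_le_gronwallBound_of_norm_deriv_right_le (f := fun t => ∫ s in (0 : ℝ)..t, |x s|)
    (f' := fun t => |x t|) (δ := 0) (K := U) (ε := c) (a := 0) (b := T)
    (fun t _ => (hG t).continuousAt.continuousWithinAt) (fun t _ => (hG t).hasDerivWithinAt)
    (by simp) (fun t ht => by
      rw [Real.norm_eq_abs, abs_abs, Real.norm_of_nonneg (hG0 t ht.1)]
      linarith [key t (Ico_subset_Icc_self ht)]) t ht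
  rw [Real.norm_of_nonneg (hG0 t ht.1), sub_zero] at hgr
  have hmono := gronwallBound_mono (le_refl (0 : ℝ)) hc0 hU.le ht.2
  have := mul_le_mul_of_nonneg_left (hgr.trans hmono) hU.le
  linarith [key t ht]

theorem mul_add_mul_integral_le {f v : ℝ → ℝ} {s t m q : ℝ} (hst : s ≤ t)
    (hf : IntervalIntegrable f volume s t) (hv : IntervalIntegrable v volume s t)
    (h : ∀ r ∈ Icc s t, m + q * v r ≤ f r) :
    (t - s) * m + q * (∫ r in s..t, v r) ≤ ∫ r in s..t, f r := by
  have hc : IntervalIntegrable (fun _ : ℝ => m) volume s t := intervalIntegrable_const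
  have := intervalIntegral.integral_mono_on hst (hc.add (hv.const_mul q)) hf h
  rwa [intervalIntegral.integral_add hc (hv.const_mul q), intervalIntegral.integral_const,
    intervalIntegral.integral_const_mul, smul_eq_mul] at this

/-- Relaxed trajectories: Lipschitz curves `(x, y, c)`, where `c` is the accumulated running cost,
subject to finite-difference inequalities which are stable under pointwise limits. -/
structure RelaxedTrajectory (T δ ρ β μid U V C : ℝ) (α x y c : ℝ → ℝ) : Prop where
  lip_x : ∀ s t, |x s - x t| ≤ V * |s - t|
  lip_y : ∀ s t, |y s - y t| ≤ V * |s - t|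
  lip_c : ∀ s t, |c s - c t| ≤ V * |s - t|
  x_ge : ∀ s ∈ Icc 0 T, ∀ t ∈ Icc s T,
    (t - s) * (α s - max 0 (U * (α s + x s))) - C * (t - s) ^ 2 ≤ x t - x s
  x_le : ∀ s ∈ Icc 0 T, ∀ t ∈ Icc s T,
    (t - s) * (-(α s - min 0 (U * (α s + x s)))) - C * (t - s) ^ 2 ≤ -x t - -x s
  y_mono : ∀ s ∈ Icc 0 T, ∀ t ∈ Icc s T, y s ≤ y t
  y_ge : ∀ s ∈ Icc 0 T, ∀ t ∈ Icc s T,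
    psiδ δ (x s - y s) * (x t - x s) - C * (t - s) ^ 2 ≤ y t - y s
  c_ge : ∀ s ∈ Icc 0 T, ∀ t ∈ Icc s T, ∀ p,
    (t - s) * (ρ * x s + β * (2 * p * (α s - μid) - p ^ 2)) - 2 * β * p * (x t - x s)
      - C * (1 + |p|) * (t - s) ^ 2 ≤ c t - c s

theorem abs_sub_le_of_integral_eq {T V : ℝ} (hT : 0 ≤ T) {f v : ℝ → ℝ}
    (hproj : ∀ t, f (projIcc 0 T hT t) = f t) (hv : ∀ t, |v t| ≤ V)
    (hf : ∀ s ∈ Icc 0 T, ∀ t ∈ Icc 0 T, f t - f s = ∫ r in s..t, v r) (s t : ℝ) :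
    |f s - f t| ≤ V * |s - t| := by
  rw [← hproj s, ← hproj t, hf _ (projIcc 0 T hT t).2 _ (projIcc 0 T hT s).2, ← Real.norm_eq_abs]
  refine (intervalIntegral.norm_integral_le_of_norm_le_const fun r _ => hv r).trans ?_
  exact mul_le_mul_of_nonneg_left (abs_projIcc_sub_projIcc hT) ((abs_nonneg _).trans (hv 0))

set_option maxHeartbeats 400000 in
theorem exists_relaxedTrajectory_constants {T δ ρ β μid U A K M : ℝ} (hT : 0 ≤ T) (hδ : 0 < δ)
    (hβ : 0 < β) (hU : 0 < U) (hM : 0 ≤ M) {α : ℝ → ℝ}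
    (hαK : ∀ s t, |α s - α t| ≤ K * |s - t|) (hαc : Continuous α) (hαA : ∀ t, |α t| ≤ A) :
    ∃ V C : ℝ, 0 ≤ V ∧ ∀ u x y c : ℝ → ℝ, AdmissibleQ U u → Continuous x → Continuous y →
      (∀ t, |x t| ≤ M) →
      (∀ t, x (projIcc 0 T hT t) = x t) → (∀ t, y (projIcc 0 T hT t) = y t) →
      (∀ t, c (projIcc 0 T hT t) = c t) →
      (∀ s ∈ Icc 0 T, ∀ t ∈ Icc 0 T, x t - x s = ∫ r in s..t, (α r - (α r + x r) * u r)) →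
      (∀ s ∈ Icc 0 T, ∀ t ∈ Icc 0 T, y t - y s =
        ∫ r in s..t, max (α r - (α r + x r) * u r) 0 * psiδ δ (x r - y r)) →
      (∀ s ∈ Icc 0 T, ∀ t ∈ Icc 0 T, c t - c s =
        ∫ r in s..t, (ρ * x r + β * ((α r + x r) * u r - μid) ^ 2)) →
      RelaxedTrajectory T δ ρ β μid U V C α x y c := by
  have hA : 0 ≤ A := (abs_nonneg _).trans (hαA 0)
  have hK : 0 ≤ K := by simpa using (abs_nonneg _).trans (hαK 1 0)
  set V₁ := A + (A + M) * U with hV₁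
  set W := |ρ| * M + β * ((A + M) * U + |μid|) ^ 2 with hW
  set V := V₁ + W with hV
  have hV₁0 : 0 ≤ V₁ := by positivity
  have hW0 : 0 ≤ W := by positivity
  have hV0 : 0 ≤ V := by positivity
  set C₁ := K + (K + V) * U with hC₁
  set C₂ := V * (2 * V / δ) with hC₂
  set C₃ := |ρ| * V + 2 * β * K with hC₃
  have hC₁0 : 0 ≤ C₁ := by positivity
  have hC₂0 : 0 ≤ C₂ := by positivity
  have hC₃0 : 0 ≤ C₃ := by positivity
  set C := C₁ + C₂ + C₃ with hC
  have hC₁C : ∀ s t : ℝ, C₁ * (t - s) ^ 2 ≤ C * (t - s) ^ 2 := fun s t => by gcongr; linarith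
  have hC₂C : ∀ s t : ℝ, C₂ * (t - s) ^ 2 ≤ C * (t - s) ^ 2 := fun s t => by gcongr; linarith
  refine ⟨V, C, hV0, ?_⟩
  intro u x y c hu hx hy hxM hpx hpy hpc hxi hyi hci
  set v : ℝ → ℝ := fun r => α r - (α r + x r) * u r with hv
  have hμb : ∀ r, |(α r + x r) * u r| ≤ (A + M) * U := by
    intro r
    rw [abs_mul, abs_of_nonneg (hu.2 r).1]
    exact mul_le_mul ((abs_add_le _ _).trans (add_le_add (hαA r) (hxM r))) (hu.2 r).2 (hu.2 r).1
      (by positivity)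
  have hvb₁ : ∀ r, |v r| ≤ V₁ := fun r => (abs_sub _ _).trans (add_le_add (hαA r) (hμb r))
  have hvb : ∀ r, |v r| ≤ V := fun r => (hvb₁ r).trans (by linarith)
  have hvm : Measurable v := hαc.measurable.sub ((hαc.add hx).measurable.mul hu.1)
  have hvI := intervalIntegrable_of_measurable_of_abs_le hvm hvb
  set g : ℝ → ℝ := fun r => max (v r) 0 * psiδ δ (x r - y r) with hg
  have hmaxb : ∀ r, max (v r) 0 ≤ V := fun r => max_le ((le_abs_self _).trans (hvb r)) hV0
  have hg0 : ∀ r, 0 ≤ g r := fun r => mul_nonneg (le_max_right _ _) (psiδ_nonneg hδ _)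
  have hgb : ∀ r, |g r| ≤ V := by
    intro r
    rw [abs_of_nonneg (hg0 r)]
    exact (mul_le_of_le_one_right (le_max_right _ _) (psiδ_le_one hδ _)).trans (hmaxb r)
  have hgm : Measurable g := (hvm.max measurable_const).mul
    ((continuous_psiδ hδ).comp (hx.sub hy)).measurable
  have hgI := intervalIntegrable_of_measurable_of_abs_le hgm hgb
  set f : ℝ → ℝ := fun r => ρ * x r + β * ((α r + x r) * u r - μid) ^ 2 with hf
  have hfb : ∀ r, |f r| ≤ V := by
    intro r
    have h1 : |ρ * x r| ≤ |ρ| * M := by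
      rw [abs_mul]; exact mul_le_mul_of_nonneg_left (hxM r) (abs_nonneg _)
    have h2 : |β * ((α r + x r) * u r - μid) ^ 2| ≤ β * ((A + M) * U + |μid|) ^ 2 := by
      rw [abs_mul, abs_of_pos hβ, abs_pow]
      have := (abs_sub ((α r + x r) * u r) μid).trans (add_le_add_left (hμb r) _)
      gcongr
    exact ((abs_add_le _ _).trans (add_le_add h1 h2)).trans (by linarith)
  have hfm : Measurable f := (hx.measurable.const_mul ρ).add
    (((((hαc.add hx).measurable.mul hu.1).sub_const μid).pow_const 2).const_mul β)
  have hfI := intervalIntegrable_of_measurable_of_abs_le hfm hfb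
  have hlx := abs_sub_le_of_integral_eq hT hpx hvb hxi
  have hly := abs_sub_le_of_integral_eq hT hpy hgb hyi
  have hmem : ∀ {s t : ℝ}, s ∈ Icc 0 T → t ∈ Icc s T → t ∈ Icc 0 T := fun hs ht =>
    ⟨hs.1.trans ht.1, ht.2⟩
  have hrs : ∀ {s t r : ℝ}, r ∈ Icc s t → |r - s| ≤ t - s := fun hr => by
    rw [abs_of_nonneg (by linarith [hr.1])]; linarith [hr.2]
  have hxr : ∀ {s t r : ℝ}, r ∈ Icc s t → |x r - x s| ≤ V * (t - s) := fun hr =>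
    (hlx _ _).trans (mul_le_mul_of_nonneg_left (hrs hr) hV0)
  have hyr : ∀ {s t r : ℝ}, r ∈ Icc s t → |y r - y s| ≤ V * (t - s) := fun hr =>
    (hly _ _).trans (mul_le_mul_of_nonneg_left (hrs hr) hV0)
  have hαr : ∀ {s t r : ℝ}, r ∈ Icc s t → |α r - α s| ≤ K * (t - s) := fun hr =>
    (hαK _ _).trans (mul_le_mul_of_nonneg_left (hrs hr) hK)
  have hμr : ∀ {s t r : ℝ}, r ∈ Icc s t →
      |(α r + x r) * u r - (α s + x s) * u r| ≤ (K + V) * U * (t - s) := by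
    intro s t r hr
    have h0 : (α r + x r) * u r - (α s + x s) * u r = ((α r - α s) + (x r - x s)) * u r := by ring
    rw [h0, abs_mul, abs_of_nonneg (hu.2 r).1]
    have h1 := (abs_add_le (α r - α s) (x r - x s)).trans (add_le_add (hαr hr) (hxr hr))
    calc _ ≤ (K * (t - s) + V * (t - s)) * U :=
          mul_le_mul h1 (hu.2 r).2 (hu.2 r).1 ((abs_nonneg _).trans h1)
      _ = _ := by ring
  refine ⟨hlx, hly, abs_sub_le_of_integral_eq hT hpc hfb hci, ?_, ?_, ?_, ?_, ?_⟩
  · intro s hs t ht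
    rw [hxi s hs t (hmem hs ht)]
    have h := mul_add_mul_integral_le (m := α s - max 0 (U * (α s + x s)) - C₁ * (t - s)) (q := 0)
      ht.1 (hvI s t) (hvI s t) (fun r hr => by
        have h1 := abs_le.mp (hαr hr)
        have h2 := abs_le.mp (hμr hr)
        have h3 : (α s + x s) * u r ≤ max 0 (U * (α s + x s)) := by
          rcases le_total 0 (α s + x s) with hk | hk
          · exact le_max_of_le_right (by nlinarith [(hu.2 r).2])
          · exact le_max_of_le_left (mul_nonpos_of_nonpos_of_nonneg hk (hu.2 r).1)
        simp only [hv, hC₁]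
        linarith [h1.1, h2.2])
    linarith [hC₁C s t]
  · intro s hs t ht
    have hxi' : -x t - -x s = ∫ r in s..t, -v r := by
      rw [intervalIntegral.integral_neg, ← hxi s hs t (hmem hs ht)]; ring
    rw [hxi']
    have h := mul_add_mul_integral_le
      (m := -(α s - min 0 (U * (α s + x s))) - C₁ * (t - s)) (q := 0)
      ht.1 (hvI s t).neg (hvI s t) (fun r hr => by
        have h1 := abs_le.mp (hαr hr)
        have h2 := abs_le.mp (hμr hr)
        have h3 : min 0 (U * (α s + x s)) ≤ (α s + x s) * u r := by
          rcases le_total 0 (α s + x s) with hk | hk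
          · exact min_le_of_left_le (mul_nonneg hk (hu.2 r).1)
          · exact min_le_of_right_le (by nlinarith [(hu.2 r).2])
        simp only [hv, hC₁, Pi.neg_apply]
        linarith [h1.2, h2.1])
    simp only [Pi.neg_apply] at h
    linarith [hC₁C s t]
  · intro s hs t ht
    rw [← sub_nonneg, hyi s hs t (hmem hs ht)]
    exact intervalIntegral.integral_nonneg ht.1 fun r _ => hg0 r
  · intro s hs t ht
    rw [hyi s hs t (hmem hs ht), hxi s hs t (hmem hs ht)]
    have h := mul_add_mul_integral_le (m := -(C₂ * (t - s))) (q := psiδ δ (x s - y s))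
      ht.1 (hgI s t) (hvI s t) (fun r hr => by
        have h1 := (abs_le.mp (abs_psiδ_sub_le hδ (x r - y r) (x s - y s))).1
        have h2 : |x r - y r - (x s - y s)| ≤ 2 * V * (t - s) := by
          rw [sub_sub_sub_comm]
          exact (abs_sub _ _).trans (by linarith [hxr hr, hyr hr])
        have h3 : |x r - y r - (x s - y s)| / δ ≤ 2 * V / δ * (t - s) := by
          rw [div_mul_eq_mul_div]; gcongr
        have h4 : psiδ δ (x s - y s) * v r ≤ psiδ δ (x s - y s) * max (v r) 0 :=
          mul_le_mul_of_nonneg_left (le_max_left _ _) (psiδ_nonneg hδ _)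
        have h5 : max (v r) 0 * (psiδ δ (x s - y s) - psiδ δ (x r - y r))
            ≤ V * (2 * V / δ * (t - s)) :=
          mul_le_mul_of_nonneg (hmaxb r) (by linarith) (le_max_right _ _) (by
            have : 0 ≤ t - s := sub_nonneg.mpr ht.1
            positivity)
        simp only [hg, hC₂]
        linarith)
    linarith [hC₂C s t]
  · intro s hs t ht p
    rw [hci s hs t (hmem hs ht), hxi s hs t (hmem hs ht)]
    have hts : 0 ≤ t - s := sub_nonneg.mpr ht.1
    have h := mul_add_mul_integral_le
      (m := ρ * x s + β * (2 * p * (α s - μid) - p ^ 2) - C₃ * (1 + |p|) * (t - s))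
      (q := -(2 * β * p)) ht.1 (hfI s t) (hvI s t) (fun r hr => by
        have h1 : |ρ * (x r - x s)| ≤ |ρ| * (V * (t - s)) := by
          rw [abs_mul]; exact mul_le_mul_of_nonneg_left (hxr hr) (abs_nonneg _)
        have h2 : |2 * β * (p * (α r - α s))| ≤ 2 * β * (|p| * (K * (t - s))) := by
          rw [abs_mul, abs_of_pos (by positivity : 0 < 2 * β), abs_mul]
          have := hαr hr
          gcongr
        have h3 : 0 ≤ β * ((α r + x r) * u r - μid - p) ^ 2 := by positivity
        have h4 := (abs_le.mp h1).1
        have h5 := (abs_le.mp h2).1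
        have h6 : |ρ| * (V * (t - s)) + 2 * β * (|p| * (K * (t - s)))
            ≤ C₃ * (1 + |p|) * (t - s) := by
          have e1 : 0 ≤ |ρ| * V * |p| * (t - s) := by positivity
          have e2 : 0 ≤ 2 * β * K * (t - s) := by positivity
          rw [hC₃]; linarith
        simp only [hv, hf]
        linarith)
    have e : C₃ * (1 + |p|) * (t - s) ^ 2 ≤ C * (1 + |p|) * (t - s) ^ 2 := by
      gcongr; linarith
    linarith

theorem isCompact_relaxedTrajectory {T δ ρ β μid U V C : ℝ} (hδ : 0 < δ) (α : ℝ → ℝ)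
    (x₀ y₀ : ℝ) :
    IsCompact {z : (ℝ → ℝ) × (ℝ → ℝ) × (ℝ → ℝ) | z.1 0 = x₀ ∧ z.2.1 0 = y₀ ∧ z.2.2 0 = 0 ∧
      RelaxedTrajectory T δ ρ β μid U V C α z.1 z.2.1 z.2.2} := by
  have hbox : ∀ b : ℝ, IsCompact (univ.pi fun t : ℝ => Icc (b - V * |t|) (b + V * |t|)) :=
    fun b => isCompact_univ_pi fun t => isCompact_Icc
  refine ((hbox x₀).prod ((hbox y₀).prod (hbox 0))).of_isClosed_subset ?_ ?_
  · have hψ : ∀ s, Continuous fun z : (ℝ → ℝ) × (ℝ → ℝ) × (ℝ → ℝ) =>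
        psiδ δ (z.1 s - z.2.1 s) := fun s => (continuous_psiδ hδ).comp (by fun_prop)
    have e : {z : (ℝ → ℝ) × (ℝ → ℝ) × (ℝ → ℝ) | z.1 0 = x₀ ∧ z.2.1 0 = y₀ ∧ z.2.2 0 = 0 ∧
        RelaxedTrajectory T δ ρ β μid U V C α z.1 z.2.1 z.2.2} =
        {z | z.1 0 = x₀ ∧ z.2.1 0 = y₀ ∧ z.2.2 0 = 0 ∧
          (∀ s t, |z.1 s - z.1 t| ≤ V * |s - t|) ∧
          (∀ s t, |z.2.1 s - z.2.1 t| ≤ V * |s - t|) ∧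
          (∀ s t, |z.2.2 s - z.2.2 t| ≤ V * |s - t|) ∧
          (∀ s ∈ Icc 0 T, ∀ t ∈ Icc s T,
            (t - s) * (α s - max 0 (U * (α s + z.1 s))) - C * (t - s) ^ 2 ≤ z.1 t - z.1 s) ∧
          (∀ s ∈ Icc 0 T, ∀ t ∈ Icc s T,
            (t - s) * (-(α s - min 0 (U * (α s + z.1 s)))) - C * (t - s) ^ 2
              ≤ -z.1 t - -z.1 s) ∧
          (∀ s ∈ Icc 0 T, ∀ t ∈ Icc s T, z.2.1 s ≤ z.2.1 t) ∧
          (∀ s ∈ Icc 0 T, ∀ t ∈ Icc s T,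
            psiδ δ (z.1 s - z.2.1 s) * (z.1 t - z.1 s) - C * (t - s) ^ 2
              ≤ z.2.1 t - z.2.1 s) ∧
          (∀ s ∈ Icc 0 T, ∀ t ∈ Icc s T, ∀ p,
            (t - s) * (ρ * z.1 s + β * (2 * p * (α s - μid) - p ^ 2))
              - 2 * β * p * (z.1 t - z.1 s) - C * (1 + |p|) * (t - s) ^ 2
              ≤ z.2.2 t - z.2.2 s)} := by
      ext z
      exact ⟨fun ⟨h1, h2, h3, h4, h5, h6, h7, h8, h9, h10, h11⟩ =>
        ⟨h1, h2, h3, h4, h5, h6, h7, h8, h9, h10, h11⟩,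
        fun ⟨h1, h2, h3, h4, h5, h6, h7, h8, h9, h10, h11⟩ =>
        ⟨h1, h2, h3, h4, h5, h6, h7, h8, h9, h10, h11⟩⟩
    rw [e]
    simp only [Set.ofPred_and, Set.ofPred_forall]
    refine (isClosed_eq (by fun_prop) (by fun_prop)).inter <|
      (isClosed_eq (by fun_prop) (by fun_prop)).inter <|
      (isClosed_eq (by fun_prop) (by fun_prop)).inter <|
      IsClosed.inter ?_ <| IsClosed.inter ?_ <| IsClosed.inter ?_ <| IsClosed.inter ?_ <|
      IsClosed.inter ?_ <| IsClosed.inter ?_ <| IsClosed.inter ?_ ?_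
    all_goals
      repeat' refine isClosed_iInter fun _ => ?_
      exact isClosed_le (by fun_prop) (by fun_prop)
  · rintro ⟨x, y, c⟩ ⟨hx, hy, hc, h⟩
    have aux : ∀ {f : ℝ → ℝ} {b : ℝ}, f 0 = b → (∀ s t, |f s - f t| ≤ V * |s - t|) →
        f ∈ univ.pi fun t : ℝ => Icc (b - V * |t|) (b + V * |t|) := by
      intro f b hb hf t _
      have := abs_le.mp (hf t 0)
      rw [hb, sub_zero] at this
      exact ⟨by linarith [this.1], by linarith [this.2]⟩
    exact ⟨aux hx h.lip_x, aux hy h.lip_y, aux hc h.lip_c⟩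

theorem le_deriv_of_forall_sub_ge {f : ℝ → ℝ} {f' s T a C : ℝ} (hf : HasDerivAt f f' s)
    (hsT : s < T) (h : ∀ t ∈ Icc s T, (t - s) * a - C * (t - s) ^ 2 ≤ f t - f s) : a ≤ f' := by
  have h1 : Filter.Tendsto (slope f s) (nhdsWithin s (Ioi s)) (nhds f') :=
    (hasDerivWithinAt_iff_tendsto_slope' self_notMem_Ioi).mp hf.hasDerivWithinAt
  have h2 : Filter.Tendsto (fun t => a - C * (t - s)) (nhdsWithin s (Ioi s)) (nhds a) := by
    have : Continuous fun t => a - C * (t - s) := by fun_prop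
    simpa using (this.tendsto s).mono_left nhdsWithin_le_nhds
  refine le_of_tendsto_of_tendsto h2 h1 ?_
  filter_upwards [Ioc_mem_nhdsGT hsT] with t ht
  have hpos : 0 < t - s := sub_pos.mpr ht.1
  rw [slope_def_field, le_div_iff₀ hpos]
  linarith [h t (Ioc_subset_Icc_self ht)]

theorem exists_control_eq {U k w : ℝ} (hU : 0 < U) (h1 : min 0 (U * k) ≤ w)
    (h2 : w ≤ max 0 (U * k)) : k * max 0 (min U (w / k)) = w := by
  rcases lt_trichotomy k 0 with hk | hk | hk
  · have hUk : U * k < 0 := mul_neg_of_pos_of_neg hU hk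
    rw [min_eq_right hUk.le] at h1
    rw [max_eq_left hUk.le] at h2
    have h3 : w / k ≤ U := by rw [div_le_iff_of_neg hk]; exact h1
    rw [min_eq_right h3, max_eq_right (div_nonneg_of_nonpos h2 hk.le)]
    exact mul_div_cancel₀ w hk.ne
  · subst hk
    simp only [mul_zero, min_self, max_self] at h1 h2
    rw [zero_mul, le_antisymm h2 h1]
  · have hUk : 0 < U * k := mul_pos hU hk
    rw [min_eq_left hUk.le] at h1
    rw [max_eq_right hUk.le] at h2
    have h3 : w / k ≤ U := by rw [div_le_iff₀ hk]; exact h2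
    rw [min_eq_right h3, max_eq_right (div_nonneg h1 hk.le)]
    exact mul_div_cancel₀ w hk.ne'

theorem lipschitz_integral_deriv {f : ℝ → ℝ} {V : ℝ≥0} (hf : LipschitzWith V f) (s t : ℝ) :
    IntervalIntegrable (deriv f) volume s t ∧ ∫ r in s..t, deriv f r = f t - f s :=
  have h := hf.lipschitzOnWith (s := uIcc s t) |>.absolutelyContinuousOnInterval
  ⟨h.intervalIntegrable_deriv, h.integral_deriv_eq_sub⟩

theorem RelaxedTrajectory.ae_deriv {T δ ρ β μid U V C : ℝ} {α x y c : ℝ → ℝ} (hV : 0 ≤ V)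
    (h : RelaxedTrajectory T δ ρ β μid U V C α x y c) :
    ∀ᵐ s, s ∈ Icc 0 T →
      min 0 (U * (α s + x s)) ≤ α s - deriv x s ∧ α s - deriv x s ≤ max 0 (U * (α s + x s)) ∧
      0 ≤ deriv y s ∧ psiδ δ (x s - y s) * deriv x s ≤ deriv y s ∧
      ρ * x s + β * (α s - deriv x s - μid) ^ 2 ≤ deriv c s := by
  have lip : ∀ {f : ℝ → ℝ}, (∀ s t, |f s - f t| ≤ V * |s - t|) → LipschitzWith V.toNNReal f :=
    fun hf => LipschitzWith.of_dist_le_mul fun s t => by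
      rw [Real.dist_eq, Real.dist_eq, Real.coe_toNNReal V hV]; exact hf s t
  have hne : ∀ᵐ s : ℝ, s ≠ T := by
    rw [ae_iff]; simp
  filter_upwards [(lip h.lip_x).ae_differentiableAt_real, (lip h.lip_y).ae_differentiableAt_real,
    (lip h.lip_c).ae_differentiableAt_real, hne] with s hdx hdy hdc hsne hs
  have hsT : s < T := lt_of_le_of_ne hs.2 hsne
  have dx := hdx.hasDerivAt
  have dy := hdy.hasDerivAt
  have dc := hdc.hasDerivAt
  have h1 := le_deriv_of_forall_sub_ge dx hsT (h.x_ge s hs)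
  have h2 := le_deriv_of_forall_sub_ge dx.fun_neg hsT (h.x_le s hs)
  refine ⟨by linarith, by linarith, ?_, ?_, ?_⟩
  · refine le_deriv_of_forall_sub_ge (C := 0) dy hsT fun t ht => ?_
    linarith [h.y_mono s hs t ht]
  · have := le_deriv_of_forall_sub_ge (a := 0) (C := C)
      (dy.fun_sub (dx.const_mul (psiδ δ (x s - y s)))) hsT fun t ht => by
        linarith [h.y_ge s hs t ht]
    linarith
  · set p := α s - deriv x s - μid with hp
    have := le_deriv_of_forall_sub_ge
      (a := ρ * x s + β * (2 * p * (α s - μid) - p ^ 2)) (C := C * (1 + |p|))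
      (dc.fun_add (dx.const_mul (2 * β * p))) hsT fun t ht => by
        linarith [h.c_ge s hs t ht p]
    have e : p ^ 2 = 2 * p * (α s - μid) - p ^ 2 - 2 * p * deriv x s := by rw [hp]; ring
    rw [e]
    linarith

/-- A relaxed trajectory is dominated by the state of an admissible control. -/
theorem RelaxedTrajectory.exists_state {T δ ρ β μid U V C : ℝ} {α x y c : ℝ → ℝ}
    (hT : 0 < T) (hδ : 0 < δ) (hU : 0 < U) (hV : 0 ≤ V) (hα : Continuous α)
    (h : RelaxedTrajectory T δ ρ β μid U V C α x y c) :
    ∃ u z : ℝ → ℝ, AdmissibleQ U u ∧ IsStateQ T δ α u (x 0) (y 0) x z ∧ z T ≤ y T ∧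
      ∫ t in (0 : ℝ)..T, (ρ * x t + β * ((α t + x t) * u t - μid) ^ 2) ≤ c T - c 0 := by
  have lip : ∀ {f : ℝ → ℝ}, (∀ s t, |f s - f t| ≤ V * |s - t|) → LipschitzWith V.toNNReal f :=
    fun hf => LipschitzWith.of_dist_le_mul fun s t => by
      rw [Real.dist_eq, Real.dist_eq, Real.coe_toNNReal V hV]; exact hf s t
  have hlx := lip h.lip_x
  have hly := lip h.lip_y
  have hlc := lip h.lip_c
  have hdb : ∀ t, |deriv x t| ≤ V := fun t => by
    have := norm_deriv_le_of_lipschitz (x₀ := t) hlx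
    rwa [Real.coe_toNNReal V hV] at this
  have hdm : Measurable (deriv x) := measurable_deriv x
  set u : ℝ → ℝ := fun t => max 0 (min U ((α t - deriv x t) / (α t + x t))) with hu
  have hum : Measurable u := measurable_const.max (measurable_const.min
    ((hα.measurable.sub hdm).div (hα.add hlx.continuous).measurable))
  have huad : AdmissibleQ U u :=
    ⟨hum, fun t => ⟨le_max_left _ _, max_le hU.le (min_le_left _ _)⟩⟩
  have hae : ∀ᵐ s, s ∈ Icc 0 T → (α s + x s) * u s = α s - deriv x s := by
    filter_upwards [h.ae_deriv hV] with s hs hsT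
    exact exists_control_eq hU (hs hsT).1 (hs hsT).2.1
  have hsub : ∀ {t s : ℝ}, t ∈ Icc 0 T → s ∈ uIoc 0 t → s ∈ Icc 0 T := fun ht hs => by
    rw [uIoc_of_le ht.1] at hs
    exact ⟨hs.1.le, hs.2.trans ht.2⟩
  obtain ⟨z, hzc, hz⟩ := exists_peak_solution (V := V) hT.le hδ (a := fun t => max (deriv x t) 0)
    (hdm.max measurable_const) (fun t => by
      rw [abs_of_nonneg (le_max_right _ _)]
      exact max_le ((le_abs_self _).trans (hdb t)) hV) hlx.continuous (y 0)
  have hgI : ∀ p q : ℝ, IntervalIntegrable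
      (fun s => max (deriv x s) 0 * psiδ δ (x s - z s)) volume p q := by
    refine intervalIntegrable_of_measurable_of_abs_le (C := V) ?_ fun t => ?_
    · exact (hdm.max measurable_const).mul
        ((continuous_psiδ hδ).comp (hlx.continuous.sub hzc)).measurable
    · rw [abs_of_nonneg (mul_nonneg (le_max_right _ _) (psiδ_nonneg hδ _))]
      exact (mul_le_of_le_one_right (le_max_right _ _) (psiδ_le_one hδ _)).trans
        (max_le ((le_abs_self _).trans (hdb t)) hV)
  have h0T : (0 : ℝ) ∈ Icc 0 T := left_mem_Icc.mpr hT.le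
  have hTT : T ∈ Icc 0 T := right_mem_Icc.mpr hT.le
  refine ⟨u, z, huad, ⟨hlx.continuous.continuousOn, hzc.continuousOn, fun t ht => ⟨?_, ?_⟩⟩, ?_, ?_⟩
  · rw [← sub_eq_iff_eq_add', ← (lipschitz_integral_deriv hlx 0 t).2]
    refine intervalIntegral.integral_congr_ae ?_
    filter_upwards [hae] with s hs hs'
    rw [hs (hsub ht hs')]; ring
  · rw [hz t ht]
    congr 1
    refine intervalIntegral.integral_congr_ae ?_
    filter_upwards [hae] with s hs hs'
    rw [hs (hsub ht hs'), sub_sub_cancel]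
  · by_contra! hlt
    have hz0 : z 0 = y 0 := by simpa using hz 0 h0T
    obtain ⟨t₀, ⟨⟨ht₀, hle⟩, hgr⟩⟩ : ∃ t₀, IsGreatest (Icc 0 T ∩ {t | z t ≤ y t}) t₀ :=
      (isCompact_Icc.inter_right (isClosed_le hzc hly.continuous)).exists_isGreatest
        ⟨0, h0T, hz0.le⟩
    have hafter : ∀ s ∈ Ioc t₀ T, y s < z s := by
      intro s hs
      by_contra! hcon
      exact absurd (hgr ⟨⟨ht₀.1.trans hs.1.le, hs.2⟩, hcon⟩) (not_le.mpr hs.1)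
    have hmono : ∫ s in t₀..T, max (deriv x s) 0 * psiδ δ (x s - z s)
        ≤ ∫ s in t₀..T, deriv y s := by
      refine intervalIntegral.integral_mono_ae_restrict ht₀.2 (hgI _ _)
        (lipschitz_integral_deriv hly _ _).1 ?_
      have hne : ∀ᵐ s : ℝ, s ≠ t₀ := by
        rw [ae_iff]; simp
      refine (ae_restrict_iff' measurableSet_Icc).mpr ?_
      filter_upwards [h.ae_deriv hV, hne] with s hs hsne hst
      obtain ⟨-, -, hy0, hy1, -⟩ := hs ⟨ht₀.1.trans hst.1, hst.2⟩
      have hlt' := hafter s ⟨lt_of_le_of_ne hst.1 hsne.symm, hst.2⟩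
      calc max (deriv x s) 0 * psiδ δ (x s - z s)
          ≤ max (deriv x s) 0 * psiδ δ (x s - y s) :=
            mul_le_mul_of_nonneg_left (psiδ_monotone hδ (by linarith)) (le_max_right _ _)
        _ ≤ deriv y s := by
            rcases le_total (deriv x s) 0 with hd | hd
            · rwa [max_eq_right hd, zero_mul]
            · rwa [max_eq_left hd, mul_comm]
    have hsplit := intervalIntegral.integral_add_adjacent_intervals (hgI 0 t₀) (hgI t₀ T)
    have e1 := hz T hTT
    have e2 := hz t₀ ht₀
    rw [(lipschitz_integral_deriv hly t₀ T).2] at hmono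
    simp only [mem_ofPred_eq] at hle
    linarith
  · rw [← (lipschitz_integral_deriv hlc 0 T).2]
    have hcongr : ∫ t in (0 : ℝ)..T, (ρ * x t + β * ((α t + x t) * u t - μid) ^ 2)
        = ∫ t in (0 : ℝ)..T, (ρ * x t + β * (α t - deriv x t - μid) ^ 2) := by
      refine intervalIntegral.integral_congr_ae ?_
      filter_upwards [hae] with s hs hs'
      rw [hs (hsub hTT hs')]
    rw [hcongr]
    refine intervalIntegral.integral_mono_ae_restrict hT.le ?_
      (lipschitz_integral_deriv hlc _ _).1 ?_
    · have hg : Continuous fun t => α t - μid := hα.sub continuous_const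
      have hd2 : IntervalIntegrable (fun t => deriv x t ^ 2) volume 0 T :=
        intervalIntegrable_of_measurable_of_abs_le (C := V ^ 2) (hdm.pow_const 2) (fun t => by
          rw [abs_pow]; exact pow_le_pow_left₀ (abs_nonneg _) (hdb t) 2) _ _
      have hgd : IntervalIntegrable (fun t => (α t - μid) * deriv x t) volume 0 T :=
        (lipschitz_integral_deriv hlx 0 T).1.continuousOn_mul hg.continuousOn
      have hcts : IntervalIntegrable (fun t => ρ * x t + β * (α t - μid) ^ 2) volume 0 T :=
        ((hlx.continuous.const_mul ρ).add ((hg.pow 2).const_mul β)).intervalIntegrable _ _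
      refine ((hcts.add (hgd.const_mul (-2 * β))).add (hd2.const_mul β)).congr ?_
      exact fun t _ => by ring
    · refine (ae_restrict_iff' measurableSet_Icc).mpr ?_
      filter_upwards [h.ae_deriv hV] with s hs hsT
      exact (hs hsT).2.2.2.2

theorem IsStateQ.congr {T δ : ℝ} {α α' u x y : ℝ → ℝ} {x₀ y₀ : ℝ}
    (hα : ∀ t ∈ Icc 0 T, α t = α' t) (h : IsStateQ T δ α u x₀ y₀ x y) :
    IsStateQ T δ α' u x₀ y₀ x y := by
  refine ⟨h.1, h.2.1, fun t ht => ?_⟩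
  have hs : ∀ s ∈ uIcc 0 t, α s = α' s := fun s hs => by
    rw [uIcc_of_le ht.1] at hs
    exact hα s ⟨hs.1, hs.2.trans ht.2⟩
  refine ⟨(h.2.2 t ht).1.trans ?_, (h.2.2 t ht).2.trans ?_⟩ <;> congr 1 <;>
    exact intervalIntegral.integral_congr fun s hs' => by simp only [hs s hs']

theorem Qobj_congr {T σ ρ β η μid : ℝ} (hT : 0 ≤ T) {α α' : ℝ → ℝ} (u x y : ℝ → ℝ)
    (hα : ∀ t ∈ Icc 0 T, α t = α' t) :
    Qobj T σ ρ β η μid α u x y = Qobj T σ ρ β η μid α' u x y := by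
  unfold Qobj
  congr 3
  refine intervalIntegral.integral_congr fun s hs => ?_
  rw [uIcc_of_le hT] at hs
  simp only [hα s hs]

theorem exists_isStateQ {T δ A U : ℝ} (hT : 0 < T) (hδ : 0 < δ) (hU : 0 < U) {α : ℝ → ℝ}
    (hαc : Continuous α) (hαA : ∀ t, |α t| ≤ A) (x₀ y₀ : ℝ) :
    ∃ u x y : ℝ → ℝ, AdmissibleQ U u ∧ IsStateQ T δ α u x₀ y₀ x y := by
  have hX : Continuous fun t => x₀ + ∫ s in (0 : ℝ)..t, α s :=
    continuous_const.add (intervalIntegral.continuous_primitive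
      (fun _ _ => hαc.intervalIntegrable _ _) 0)
  obtain ⟨y, hy, hyeq⟩ := exists_peak_solution (V := A) hT.le hδ (a := fun t => max (α t) 0)
    (hαc.measurable.max measurable_const) (fun t => by
      rw [abs_of_nonneg (le_max_right _ _)]
      exact max_le ((le_abs_self _).trans (hαA t)) ((abs_nonneg _).trans (hαA t))) hX y₀
  refine ⟨fun _ => 0, _, y, ⟨measurable_const, fun _ => ⟨le_rfl, hU.le⟩⟩, hX.continuousOn,
    hy.continuousOn, fun t ht => ⟨by simp, ?_⟩⟩
  simpa using hyeq t ht

theorem exists_relaxedTrajectory_of_state {T δ ρ β μid U A K : ℝ} (hT : 0 < T) (hδ : 0 < δ)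
    (hβ : 0 < β) (hU : 0 < U) {α : ℝ → ℝ} (hαK : ∀ s t, |α s - α t| ≤ K * |s - t|)
    (hαc : Continuous α) (hαA : ∀ t, |α t| ≤ A) (x₀ y₀ : ℝ) :
    ∃ V C : ℝ, 0 ≤ V ∧ ∀ u x y : ℝ → ℝ, AdmissibleQ U u → IsStateQ T δ α u x₀ y₀ x y →
      ∃ X Y c : ℝ → ℝ, (X 0 = x₀ ∧ Y 0 = y₀ ∧ c 0 = 0 ∧
        RelaxedTrajectory T δ ρ β μid U V C α X Y c) ∧ X T = x T ∧ Y T = y T ∧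
        c T = ∫ t in (0 : ℝ)..T, (ρ * x t + β * ((α t + x t) * u t - μid) ^ 2) := by
  have hA : 0 ≤ A := (abs_nonneg _).trans (hαA 0)
  obtain ⟨M, hM, hbound⟩ := exists_state_bound hT.le hU hA x₀
  obtain ⟨V, C, hV, hrel⟩ := exists_relaxedTrajectory_constants (ρ := ρ) (μid := μid) hT.le hδ hβ
    hU hM hαK hαc hαA
  refine ⟨V, C, hV, ?_⟩
  intro u x y hu hst
  set P : ℝ → ℝ := fun t => projIcc 0 T hT.le t with hP
  have hPc : Continuous P := continuous_subtype_val.comp continuous_projIcc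
  have hPmem : ∀ t, P t ∈ Icc 0 T := fun t => (projIcc 0 T hT.le t).2
  have hPid : ∀ t ∈ Icc 0 T, P t = t := fun t ht => by simp [hP, projIcc_of_mem hT.le ht]
  have h0T : (0 : ℝ) ∈ Icc 0 T := left_mem_Icc.mpr hT.le
  have hTT : T ∈ Icc 0 T := right_mem_Icc.mpr hT.le
  set X : ℝ → ℝ := fun t => x (P t) with hXdef
  set Y : ℝ → ℝ := fun t => y (P t) with hYdef
  have hX : Continuous X := hst.1.comp_continuous hPc hPmem
  have hY : Continuous Y := hst.2.1.comp_continuous hPc hPmem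
  have hXx : ∀ t ∈ Icc 0 T, X t = x t := fun t ht => by rw [hXdef]; simp only [hPid t ht]
  have hYy : ∀ t ∈ Icc 0 T, Y t = y t := fun t ht => by rw [hYdef]; simp only [hPid t ht]
  have hsub : ∀ {t s : ℝ}, t ∈ Icc 0 T → s ∈ uIcc 0 t → s ∈ Icc 0 T := fun ht hs => by
    rw [uIcc_of_le ht.1] at hs
    exact ⟨hs.1, hs.2.trans ht.2⟩
  have hXeq : ∀ t ∈ Icc 0 T, X t = x₀ + ∫ s in (0 : ℝ)..t, (α s - (α s + X s) * u s) := by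
    intro t ht
    rw [hXx t ht, (hst.2.2 t ht).1]
    congr 1
    exact intervalIntegral.integral_congr fun s hs => by simp only [hXx s (hsub ht hs)]
  have hYeq : ∀ t ∈ Icc 0 T, Y t = y₀ + ∫ s in (0 : ℝ)..t,
      max (α s - (α s + X s) * u s) 0 * psiδ δ (X s - Y s) := by
    intro t ht
    rw [hYy t ht, (hst.2.2 t ht).2]
    congr 1
    exact intervalIntegral.integral_congr fun s hs => by
      simp only [hXx s (hsub ht hs), hYy s (hsub ht hs)]
  have hXM : ∀ t, |X t| ≤ M := fun t => by
    have := hbound α u X hαc hαA hu hX hXeq (P t) (hPmem t)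
    rwa [hXx _ (hPmem t)] at this
  have hμm : Measurable fun t => (α t + X t) * u t := (hαc.add hX).measurable.mul hu.1
  have hμb : ∀ t, |(α t + X t) * u t| ≤ (A + M) * U := fun t => by
    rw [abs_mul, abs_of_nonneg (hu.2 t).1]
    exact mul_le_mul ((abs_add_le _ _).trans (add_le_add (hαA t) (hXM t))) (hu.2 t).2 (hu.2 t).1
      (by positivity)
  have hvm : Measurable fun t => α t - (α t + X t) * u t := hαc.measurable.sub hμm
  have hvb : ∀ t, |α t - (α t + X t) * u t| ≤ A + (A + M) * U := fun t =>
    (abs_sub _ _).trans (add_le_add (hαA t) (hμb t))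
  have hvI := intervalIntegrable_of_measurable_of_abs_le hvm hvb
  have hgI := intervalIntegrable_of_measurable_of_abs_le
    (f := fun t => max (α t - (α t + X t) * u t) 0 * psiδ δ (X t - Y t))
    (C := A + (A + M) * U)
    ((hvm.max measurable_const).mul ((continuous_psiδ hδ).comp (hX.sub hY)).measurable) fun t => by
      rw [abs_of_nonneg (mul_nonneg (le_max_right _ _) (psiδ_nonneg hδ _))]
      exact (mul_le_of_le_one_right (le_max_right _ _) (psiδ_le_one hδ _)).trans
        (max_le ((le_abs_self _).trans (hvb t)) (by positivity))
  have hfI := intervalIntegrable_of_measurable_of_abs_le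
    (f := fun t => ρ * X t + β * ((α t + X t) * u t - μid) ^ 2)
    (C := |ρ| * M + β * ((A + M) * U + |μid|) ^ 2)
    ((hX.measurable.const_mul ρ).add (((hμm.sub_const μid).pow_const 2).const_mul β)) fun t => by
      refine (abs_add_le _ _).trans ?_
      rw [abs_mul, abs_mul, abs_of_pos hβ, abs_pow]
      have h1 := hXM t
      have h2 := (abs_sub ((α t + X t) * u t) μid).trans (add_le_add_left (hμb t) _)
      gcongr
  set F : ℝ → ℝ := fun t => ∫ s in (0 : ℝ)..t, (ρ * X s + β * ((α s + X s) * u s - μid) ^ 2)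
    with hF
  have hPP : ∀ t, P (P t) = P t := fun t => hPid _ (hPmem t)
  refine ⟨X, Y, fun t => F (P t), ⟨?_, ?_, ?_, hrel u X Y _ hu hX hY hXM ?_ ?_ ?_ ?_ ?_ ?_⟩,
    hXx T hTT, hYy T hTT, ?_⟩
  · simpa using hXeq 0 h0T
  · simpa using hYeq 0 h0T
  · simp [hPid 0 h0T, hF]
  · exact fun t => congrArg x (hPP t)
  · exact fun t => congrArg y (hPP t)
  · exact fun t => congrArg F (hPP t)
  · intro s hs t ht
    rw [hXeq s hs, hXeq t ht, add_sub_add_left_eq_sub,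
      intervalIntegral.integral_interval_sub_left (hvI _ _) (hvI _ _)]
  · intro s hs t ht
    rw [hYeq s hs, hYeq t ht, add_sub_add_left_eq_sub,
      intervalIntegral.integral_interval_sub_left (hgI _ _) (hgI _ _)]
  · intro s hs t ht
    rw [hPid s hs, hPid t ht]
    exact intervalIntegral.integral_interval_sub_left (hfI _ _) (hfI _ _)
  · dsimp only
    rw [hPid T hTT]
    exact intervalIntegral.integral_congr fun s hs => by simp only [hXx s (hsub hTT hs)]

theorem exists_optimal_of_lipschitz {T U δ σ ρ β η μid A K : ℝ} (hT : 0 < T) (hU : 0 < U)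
    (hδ : 0 < δ) (hσ : 0 ≤ σ) (hβ : 0 < β) {α : ℝ → ℝ}
    (hαK : ∀ s t, |α s - α t| ≤ K * |s - t|) (hαc : Continuous α) (hαA : ∀ t, |α t| ≤ A)
    (x₀ y₀ : ℝ) :
    ∃ u x y : ℝ → ℝ, AdmissibleQ U u ∧ IsStateQ T δ α u x₀ y₀ x y ∧
      ∀ u' x' y' : ℝ → ℝ, AdmissibleQ U u' → IsStateQ T δ α u' x₀ y₀ x' y' →
        Qobj T σ ρ β η μid α u' x' y' ≤ Qobj T σ ρ β η μid α u x y := by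
  obtain ⟨V, C, hV, hrel⟩ := exists_relaxedTrajectory_of_state (ρ := ρ) (μid := μid) hT hδ hβ hU
    hαK hαc hαA x₀ y₀
  have hcomp := isCompact_relaxedTrajectory (T := T) (ρ := ρ) (β := β) (μid := μid) (U := U)
    (V := V) (C := C) hδ α x₀ y₀
  obtain ⟨u₁, x₁, y₁, hu₁, hst₁⟩ := exists_isStateQ hT hδ hU hαc hαA x₀ y₀
  obtain ⟨X₁, Y₁, c₁, hmem₁, -⟩ := hrel u₁ x₁ y₁ hu₁ hst₁
  have hcont : Continuous fun z : (ℝ → ℝ) × (ℝ → ℝ) × (ℝ → ℝ) =>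
      z.2.2 T + η * z.1 T + σ * z.2.1 T := by fun_prop
  obtain ⟨⟨x, y, c⟩, ⟨hx0, hy0, hc0, hR⟩, hmin⟩ :=
    hcomp.exists_isMinOn ⟨(X₁, Y₁, c₁), hmem₁⟩ hcont.continuousOn
  dsimp only at hx0 hy0 hc0 hR
  obtain ⟨u, z, hu, hst, hzy, hcost⟩ := hR.exists_state hT hδ hU hV hαc
  rw [hx0, hy0] at hst
  refine ⟨u, x, z, hu, hst, fun u' x' y' hu' hst' => ?_⟩
  obtain ⟨X', Y', c', hmem', hX', hY', hc'⟩ := hrel u' x' y' hu' hst'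
  have hle : c T + η * x T + σ * y T ≤ c' T + η * X' T + σ * Y' T :=
    hmin (show (X', Y', c') ∈ _ from hmem')
  have := mul_le_mul_of_nonneg_left hzy hσ
  unfold Qobj
  rw [hX', hY', hc'] at hle
  linarith

/-- existence of an optimal service-rate policy for the smoothed
queueing problem with peak-congestion cost. -/
theorem exists_optimal_policy_smoothed_queue
    (T ubar δ σ ρ β η μid : ℝ)
    (hT : 0 < T) (hubar : 0 < ubar) (hδ : 0 < δ)
    (hσ : 0 ≤ σ) (hρ : 0 ≤ ρ) (hβ : 0 < β) (hη : 0 ≤ η) (hμid : 0 < μid)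
    (α : ℝ → ℝ)
    (hαLip : ∃ K : ℝ≥0, LipschitzOnWith K α (Icc 0 T))
    (hα : ∀ t ∈ Icc (0 : ℝ) T, 0 < α t)
    (x₀ y₀ : ℝ) (hxy : x₀ ≤ y₀) :
    ∃ ustar xstar ystar : ℝ → ℝ,
      AdmissibleQ ubar ustar ∧ IsStateQ T δ α ustar x₀ y₀ xstar ystar ∧
      ∀ u x y : ℝ → ℝ, AdmissibleQ ubar u → IsStateQ T δ α u x₀ y₀ x y →
        Qobj T σ ρ β η μid α u x y ≤ Qobj T σ ρ β η μid α ustar xstar ystar := by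
  obtain ⟨K, hK⟩ := hαLip
  obtain ⟨A, hA⟩ := isCompact_Icc.exists_bound_of_continuousOn hK.continuousOn
  set α' : ℝ → ℝ := fun t => α (projIcc 0 T hT.le t) with hα'
  have heq : ∀ t ∈ Icc 0 T, α t = α' t := fun t ht => by simp [hα', projIcc_of_mem hT.le ht]
  have hαK : ∀ s t, |α' s - α' t| ≤ K * |s - t| := fun s t => by
    have := hK.dist_le_mul _ (projIcc 0 T hT.le s).2 _ (projIcc 0 T hT.le t).2
    rw [Real.dist_eq, Real.dist_eq] at this
    exact this.trans (mul_le_mul_of_nonneg_left (abs_projIcc_sub_projIcc hT.le) K.2)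
  have hαc : Continuous α' := hK.continuousOn.comp_continuous
    (continuous_subtype_val.comp continuous_projIcc) fun t => (projIcc 0 T hT.le t).2
  obtain ⟨u, x, y, hu, hst, hopt⟩ := exists_optimal_of_lipschitz (σ := σ) (ρ := ρ) (η := η)
    (μid := μid) hT hubar hδ hσ hβ hαK hαc (fun t => hA _ (projIcc 0 T hT.le t).2) x₀ y₀
  refine ⟨u, x, y, hu, hst.congr fun t ht => (heq t ht).symm, fun u' x' y' hu' hst' => ?_⟩
  rw [Qobj_congr hT.le u' x' y' heq, Qobj_congr hT.le u x y heq]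
  exact hopt u' x' y' hu' (hst'.congr heq)
end
end
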